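/- Let A be a finite dimensional algebra over a field k with global dimension at most 2, and let P be a 2-term silting complex in K^b(proj A). Then the endomorphism algebra B = End_{D^b(A)}(P) has global dimension at most 7. -/

import Mathlib

/-!
Common setup: we model right `A`-modules as `ModuleCat Aᵐᵒᵖ`, the bounded derived
category `D^b(mod A)` as the full subcategory (given by the predicate `InDb`) of the
derived category of `Mod Aᵐᵒᵖ` consisting of cohomologically bounded complexes with
finitely generated cohomology, and `K^b(proj A)` via bounded complexes of finitely
generated projective modules (`IsPerfCplx`).
-/

namespace TwoTermSilting

open CategoryTheory Limits Pretriangulated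

universe w v u

noncomputable section

/-- The projective dimension of the module `M` is at most `n`. -/
def pdLE (R : Type u) [Ring R] : ℕ → ModuleCat.{v} R → Prop
  | 0, M => Projective M
  | (n+1), M => ∃ (P : ModuleCat.{v} R) (f : P ⟶ M),
      Projective P ∧ Epi f ∧ pdLE R n (kernel f)

/-- The (right) global dimension of `R` is at most `d`: every finitely generated
module has projective dimension at most `d`. -/
def gldLE (R : Type u) [Ring R] (d : ℕ) : Prop :=
  ∀ M : ModuleCat.{v} R, Module.Finite R M → pdLE R d M

section Star

variable {C : Type u} [Category.{v} C] [HasZeroObject C] [Preadditive C] [HasShift C ℤ]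
  [∀ n : ℤ, (shiftFunctor C n).Additive] [Pretriangulated C]

/-- `star S T` consists of the objects `Z` sitting in a distinguished triangle
`X ⟶ Z ⟶ Y ⟶ X⟦1⟧` with `X ∈ S` and `Y ∈ T`. -/
def star (S T : Set C) : Set C :=
  {Z | ∃ (X Y : C) (f : X ⟶ Z) (g : Z ⟶ Y) (h : Y ⟶ X⟦(1 : ℤ)⟧),
    X ∈ S ∧ Y ∈ T ∧ Triangle.mk f g h ∈ distTriang C}

/-- `starChain f n` is the iterated star product `f 0 * f 1 * ⋯ * f n`
(the star operation being associative). -/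
def starChain (f : ℕ → Set C) : ℕ → Set C
  | 0 => f 0
  | (n+1) => star (starChain f n) (f (n+1))

/-- The closure of a class of objects under the shift by `n`. -/
def shiftSet (S : Set C) (n : ℤ) : Set C :=
  {Y | ∃ X ∈ S, Nonempty (Y ≅ X⟦n⟧)}

/-- The additive closure of the object `X`: all direct summands of finite direct sums
of copies of `X`. -/
def addOf (X : C) : Set C :=
  {Y | ∃ (n : ℕ) (ι : Y ⟶ ⨁ (fun _ : Fin n => X)) (r : (⨁ (fun _ : Fin n => X)) ⟶ Y),
    ι ≫ r = 𝟙 Y}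

/-- A class of objects of a (pre)triangulated category is thick if it is closed under
isomorphisms, shifts, extensions and direct summands. -/
def IsThick (S : Set C) : Prop :=
  (∀ ⦃X Y : C⦄, (X ≅ Y) → X ∈ S → Y ∈ S) ∧
  (∀ (X : C) (n : ℤ), X ∈ S → (X⟦n⟧) ∈ S) ∧
  (∀ T : Triangle C, (T ∈ distTriang C) → T.obj₁ ∈ S → T.obj₃ ∈ S → T.obj₂ ∈ S) ∧
  (∀ (X Y : C) (ι : X ⟶ Y) (r : Y ⟶ X), ι ≫ r = 𝟙 X → Y ∈ S → X ∈ S)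

end Star

/-- The right `End Y`-module structure on `Y ⟶ X`, by precomposition. -/
instance endModule {C : Type u} [Category.{v} C] [Preadditive C] (Y X : C) :
    Module (End Y)ᵐᵒᵖ (Y ⟶ X) where
  smul b f := b.unop ≫ f
  one_smul f := Category.id_comp f
  mul_smul b₁ b₂ f := by
    show (b₁ * b₂).unop ≫ f = b₁.unop ≫ (b₂.unop ≫ f)
    have h : (b₁ * b₂).unop = b₁.unop ≫ b₂.unop := rfl
    rw [h, Category.assoc]
  smul_zero b := Limits.comp_zero
  smul_add b f g := Preadditive.comp_add _ _ _ _ _ _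
  add_smul b₁ b₂ f := Preadditive.add_comp _ _ _ _ _ _
  zero_smul f := Limits.zero_comp

section Main

variable (R : Type) [Ring R] [HasDerivedCategory.{w} (ModuleCat.{0} R)]

/-- A bounded complex of finitely generated projective modules
(an object of `K^b(proj R)`). -/
def IsPerfCplx (X : CochainComplex (ModuleCat.{0} R) ℤ) : Prop :=
  (∀ i, Projective (X.X i)) ∧ (∀ i, Module.Finite R (X.X i)) ∧
    ∃ a b : ℤ, ∀ i, (i < a ∨ b < i) → IsZero (X.X i)

/-- A complex of finitely generated projective modules concentrated in
degrees `-1` and `0`. -/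
def IsTwoTermCplx (X : CochainComplex (ModuleCat.{0} R) ℤ) : Prop :=
  (∀ i, Projective (X.X i)) ∧ (∀ i, Module.Finite R (X.X i)) ∧
    ∀ i, i ≠ -1 → i ≠ 0 → IsZero (X.X i)

/-- A two-term silting complex: a two-term complex of finitely generated projectives `P`
with `Hom_D(P, P[1]) = 0`, such that the smallest thick subcategory containing `P`
contains all of `K^b(proj R)`. -/
def IsTwoTermSilting (P : CochainComplex (ModuleCat.{0} R) ℤ) : Prop :=
  IsTwoTermCplx R P ∧
  (∀ f : DerivedCategory.Q.obj P ⟶ (DerivedCategory.Q.obj P)⟦(1 : ℤ)⟧, f = 0) ∧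
  (∀ S : Set (DerivedCategory (ModuleCat.{0} R)), IsThick S →
    DerivedCategory.Q.obj P ∈ S →
    ∀ X : CochainComplex (ModuleCat.{0} R) ℤ, IsPerfCplx R X → DerivedCategory.Q.obj X ∈ S)

/-- The objects of the derived category which belong to `D^b(mod R)`: cohomologically
bounded complexes with finitely generated cohomology. -/
def InDb (X : DerivedCategory (ModuleCat.{0} R)) : Prop :=
  (∃ a b : ℤ, ∀ i, (i < a ∨ b < i) →
    IsZero ((DerivedCategory.homologyFunctor (ModuleCat.{0} R) i).obj X)) ∧
  (∀ i : ℤ, Module.Finite R ((DerivedCategory.homologyFunctor (ModuleCat.{0} R) i).obj X))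

variable {R}

/-- The torsion class `T(P)` of finitely generated modules `X` with `Hom_D(P, X[1]) = 0`. -/
def TT (P : CochainComplex (ModuleCat.{0} R) ℤ) : Set (ModuleCat.{0} R) :=
  {X | Module.Finite R X ∧
    ∀ f : DerivedCategory.Q.obj P ⟶
      ((DerivedCategory.singleFunctor (ModuleCat.{0} R) 0).obj X)⟦(1 : ℤ)⟧, f = 0}

/-- The torsion-free class `F(P)` of finitely generated modules `Y` with `Hom_D(P, Y) = 0`. -/
def FF (P : CochainComplex (ModuleCat.{0} R) ℤ) : Set (ModuleCat.{0} R) :=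
  {Y | Module.Finite R Y ∧
    ∀ f : DerivedCategory.Q.obj P ⟶
      (DerivedCategory.singleFunctor (ModuleCat.{0} R) 0).obj Y, f = 0}

/-- The heart `C(P) = {X ∈ D^b(mod R) | Hom_D(P, X[i]) = 0 for all i ≠ 0}`. -/
def CP (P : CochainComplex (ModuleCat.{0} R) ℤ) : Set (DerivedCategory (ModuleCat.{0} R)) :=
  {X | InDb R X ∧ ∀ i : ℤ, i ≠ 0 → ∀ f : DerivedCategory.Q.obj P ⟶ X⟦i⟧, f = 0}

end Main

section ProjectiveDimension

variable {C : Type u} [Category.{v} C] [Abelian C]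

lemma hasProjectiveDimensionLT_cokernel {X Y Z : C} {f : X ⟶ Y} {g : Y ⟶ Z} {w : f ≫ g = 0}
    (hex : (ShortComplex.mk f g w).Exact) (n : ℕ)
    (h₁ : HasProjectiveDimensionLT (cokernel f) n) (h₂ : HasProjectiveDimensionLT Z (n + 1)) :
    HasProjectiveDimensionLT (cokernel g) (n + 1) := by
  let S : ShortComplex C := ShortComplex.mk (cokernel.desc f g w) (cokernel.π g) (by
    rw [← cancel_epi (cokernel.π f)]; simp)
  have hS : S.ShortExact :=
    { exact := S.exact_of_g_is_cokernel (CokernelCofork.IsColimit.ofπ' _ _ (fun {W} k hk =>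
        ⟨cokernel.desc g k (by
          have : cokernel.desc f g w ≫ k = 0 := hk
          rw [← cokernel.π_desc f g w, Category.assoc, this, comp_zero]), by simp [S]⟩))
      mono_f := hex.mono_cokernelDesc
      epi_g := by dsimp [S]; infer_instance }
  exact hS.hasProjectiveDimensionLT_X₃ n h₁ h₂

lemma shortExact_cokernel {X Y : C} (f : X ⟶ Y) [Mono f] :
    (ShortComplex.mk f (cokernel.π f) (by simp)).ShortExact :=
  { exact := ShortComplex.exact_cokernel f
    mono_f := by dsimp; infer_instance
    epi_g := by dsimp; infer_instance }

lemma shortExact_kernel {X Y : C} (f : X ⟶ Y) [Epi f] :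
    (ShortComplex.mk (kernel.ι f) f (by simp)).ShortExact :=
  { exact := ShortComplex.exact_kernel f
    mono_f := by dsimp; infer_instance
    epi_g := by dsimp; infer_instance }

/-- The short exact sequence `0 ⟶ coker f ⟶ Z ⟶ W ⟶ 0` attached to an exact sequence
`X ⟶ Y ⟶ Z ⟶ W ⟶ 0`. -/
lemma shortExact_cokernelDesc {X Y Z W : C} {f : X ⟶ Y} {g : Y ⟶ Z} {h : Z ⟶ W}
    {w : f ≫ g = 0} {w' : g ≫ h = 0} (hex : (ShortComplex.mk f g w).Exact)
    (hex' : (ShortComplex.mk g h w').Exact) (hh : Epi h) :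
    (ShortComplex.mk (cokernel.desc f g w) h
      (by rw [← cancel_epi (cokernel.π f)]; simpa using w')).ShortExact :=
  { exact := by
      let φ : ShortComplex.mk g h w' ⟶ ShortComplex.mk (cokernel.desc f g w) h
          (by rw [← cancel_epi (cokernel.π f)]; simpa using w') :=
        { τ₁ := cokernel.π f
          τ₂ := 𝟙 _
          τ₃ := 𝟙 _ }
      have : Epi φ.τ₁ := by dsimp [φ]; infer_instance
      have : IsIso φ.τ₂ := by dsimp [φ]; infer_instance
      have : Mono φ.τ₃ := by dsimp [φ]; infer_instance
      exact (ShortComplex.exact_iff_of_epi_of_isIso_of_mono φ).1 hex'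
    mono_f := hex.mono_cokernelDesc
    epi_g := hh }

section SixTerm

variable {X₀ X₁ X₂ X₃ X₄ X₅ : C} {f₀ : X₀ ⟶ X₁} {f₁ : X₁ ⟶ X₂} {f₂ : X₂ ⟶ X₃} {f₃ : X₃ ⟶ X₄}
  {f₄ : X₄ ⟶ X₅} {w₁ : f₀ ≫ f₁ = 0} {w₂ : f₁ ≫ f₂ = 0} {w₃ : f₂ ≫ f₃ = 0} {w₄ : f₃ ≫ f₄ = 0}

lemma hasProjectiveDimensionLT_last_of_sixTerm (hf₀ : Mono f₀)
    (e₁ : (ShortComplex.mk f₀ f₁ w₁).Exact) (e₂ : (ShortComplex.mk f₁ f₂ w₂).Exact)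
    (e₃ : (ShortComplex.mk f₂ f₃ w₃).Exact) (e₄ : (ShortComplex.mk f₃ f₄ w₄).Exact)
    (hf₄ : Epi f₄) (m : ℕ)
    (h₀ : HasProjectiveDimensionLT X₀ 2) (h₁ : HasProjectiveDimensionLT X₁ 2)
    (h₂ : HasProjectiveDimensionLT X₂ 2) (h₃ : HasProjectiveDimensionLT X₃ (m + 5))
    (h₄ : HasProjectiveDimensionLT X₄ (m + 6)) : HasProjectiveDimensionLT X₅ (m + 6) := by
  have c₀ : HasProjectiveDimensionLT (cokernel f₀) 3 :=
    (shortExact_cokernel f₀).hasProjectiveDimensionLT_X₃ 2 h₀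
      (hasProjectiveDimensionLT_of_ge X₁ 2 3 (by lia))
  have c₁ : HasProjectiveDimensionLT (cokernel f₁) 4 :=
    hasProjectiveDimensionLT_cokernel e₁ 3 c₀ (hasProjectiveDimensionLT_of_ge X₂ 2 4 (by lia))
  have c₂ : HasProjectiveDimensionLT (cokernel f₂) (m + 4 + 1) :=
    hasProjectiveDimensionLT_cokernel e₂ (m + 4) (hasProjectiveDimensionLT_of_ge _ 4 _ (by lia)) h₃
  exact (shortExact_cokernelDesc e₃ e₄ hf₄).hasProjectiveDimensionLT_X₃ (m + 5) c₂ h₄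

lemma hasProjectiveDimensionLT_middle_of_fiveTerm (hf₀ : Mono f₀)
    (e₁ : (ShortComplex.mk f₀ f₁ w₁).Exact) (e₂ : (ShortComplex.mk f₁ f₂ w₂).Exact)
    (e₃ : (ShortComplex.mk f₂ f₃ w₃).Exact) (hf₃ : Epi f₃) (m : ℕ)
    (h₀ : HasProjectiveDimensionLT X₀ 2) (h₁ : HasProjectiveDimensionLT X₁ 2)
    (h₃ : HasProjectiveDimensionLT X₃ (m + 3))
    (h₄ : HasProjectiveDimensionLT X₄ (m + 4)) : HasProjectiveDimensionLT X₂ (m + 3) := by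
  have c₀ : HasProjectiveDimensionLT (cokernel f₀) 3 :=
    (shortExact_cokernel f₀).hasProjectiveDimensionLT_X₃ 2 h₀
      (hasProjectiveDimensionLT_of_ge X₁ 2 3 (by lia))
  have c₁ : HasProjectiveDimensionLT (cokernel f₁) (m + 3) :=
    (shortExact_cokernelDesc e₂ e₃ hf₃).hasProjectiveDimensionLT_X₁ (m + 3) h₃ h₄
  refine ShortComplex.ShortExact.hasProjectiveDimensionLT_X₂
    (S := ShortComplex.mk (cokernel.desc f₀ f₁ w₁) (cokernel.π f₁) (by
      rw [← cancel_epi (cokernel.π f₀)]; simp)) ?_ (m + 3)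
    (hasProjectiveDimensionLT_of_ge _ 3 _ (by lia)) c₁
  exact shortExact_cokernelDesc e₁ (ShortComplex.exact_cokernel f₁) inferInstance

end SixTerm

lemma hasProjectiveDimensionLT_biproduct {m : ℕ} (f : Fin m → C) [HasBiproduct f] (n : ℕ)
    (hf : ∀ i, HasProjectiveDimensionLT (f i) n) : HasProjectiveDimensionLT (⨁ f) n := by
  let := HasExt.standard C
  rw [hasProjectiveDimensionLT_iff]
  intro i hi Y x
  refine (Abelian.Ext.biproductAddEquiv (biproduct.isBilimit f) Y i).injective ?_
  ext j
  exact (Abelian.Ext.eq_zero_of_hasProjectiveDimensionLT _ n hi).trans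
    (Abelian.Ext.eq_zero_of_hasProjectiveDimensionLT _ n hi).symm

end ProjectiveDimension

section PdLE

variable {R : Type u} [Ring R]

lemma hasProjectiveDimensionLT_of_pdLE {n : ℕ} {M : ModuleCat.{v} R} (h : pdLE R n M) :
    HasProjectiveDimensionLT M (n + 1) := by
  induction n generalizing M with
  | zero =>
    have : Projective M := h
    infer_instance
  | succ n ih =>
    obtain ⟨P, f, hP, hf, hk⟩ := h
    exact (shortExact_kernel f).hasProjectiveDimensionLT_X₃ (n + 1) (ih hk)
      (hasProjectiveDimensionLT_of_ge P 1 _ (by lia))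

lemma pdLE_of_hasProjectiveDimensionLT [Small.{v} R] {n : ℕ} {M : ModuleCat.{v} R}
    (h : HasProjectiveDimensionLT M (n + 1)) : pdLE R n M := by
  induction n generalizing M with
  | zero => exact projective_iff_hasProjectiveDimensionLT_one.2 h
  | succ n ih =>
    refine ⟨Projective.over M, Projective.π M, inferInstance, inferInstance, ih ?_⟩
    exact (shortExact_kernel (Projective.π M)).hasProjectiveDimensionLT_X₁ (n + 1)
      (hasProjectiveDimensionLT_of_ge _ 1 _ (by lia)) h

end PdLE

set_option linter.unusedSectionVars false

section Triangulated

variable {C : Type u} [Category.{v} C] [HasZeroObject C] [Preadditive C] [HasShift C ℤ]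
  [∀ n : ℤ, (shiftFunctor C n).Additive] [Pretriangulated C]

/-- The functor `Hom(p, -)` with values in right `End p`-modules. -/
def homFunctor (p : C) : C ⥤ ModuleCat.{v} (End p)ᵐᵒᵖ := preadditiveCoyonedaObj p

instance (p : C) : (homFunctor p).Additive := by
  dsimp [homFunctor]; infer_instance

instance (p : C) : (homFunctor p).ShiftSequence ℤ :=
  Functor.ShiftSequence.tautological _ _

instance (p : C) : (homFunctor p).IsHomological where
  exact T hT := by
    rw [ShortComplex.moduleCat_exact_iff]
    intro (f : p ⟶ T.obj₂) (hf : f ≫ T.mor₂ = 0)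
    obtain ⟨g, hg⟩ := T.coyoneda_exact₂ hT f hf
    exact ⟨g, hg.symm⟩

/-- The `i`-th cohomology `Hom(p, -⟦i⟧)` as a right `End p`-module. -/
abbrev homShift (p : C) (i : ℤ) : C ⥤ ModuleCat.{v} (End p)ᵐᵒᵖ := (homFunctor p).shift i

instance (p : C) (i : ℤ) : (homShift p i).Additive := by
  change (shiftFunctor C i ⋙ homFunctor p).Additive
  infer_instance

/-- The vanishing of all morphisms `S ⟶ Y⟦i⟧`. -/
def Van (S Y : C) (i : ℤ) : Prop := ∀ f : S ⟶ Y⟦i⟧, f = 0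

lemma van_iff_isZero (S Y : C) (i : ℤ) : Van S Y i ↔ IsZero ((homShift S i).obj Y) := by
  rw [ModuleCat.isZero_iff_subsingleton]
  exact ⟨fun h => ⟨fun f g => (h f).trans (h g).symm⟩, fun h f => h.elim f 0⟩

section

variable {T : Triangle C} (hT : T ∈ distTriang C) {S : C}

include hT

lemma van_obj₁ {n₀ n₁ : ℤ} (h : n₀ + 1 = n₁) (h₃ : Van S T.obj₃ n₀) (h₂ : Van S T.obj₂ n₁) :
    Van S T.obj₁ n₁ := by
  rw [van_iff_isZero] at *
  exact ((homFunctor S).homologySequence_exact₁ T hT n₀ n₁ h).isZero_of_both_zeros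
    (h₃.eq_of_src _ _) (h₂.eq_of_tgt _ _)

lemma van_obj₃ {n₀ n₁ : ℤ} (h : n₀ + 1 = n₁) (h₂ : Van S T.obj₂ n₀) (h₁ : Van S T.obj₁ n₁) :
    Van S T.obj₃ n₀ := by
  rw [van_iff_isZero] at *
  exact ((homFunctor S).homologySequence_exact₃ T hT n₀ n₁ h).isZero_of_both_zeros
    (h₂.eq_of_src _ _) (h₁.eq_of_tgt _ _)

end

lemma Van.of_retract_left {S S' Y : C} (e : S' ⟶ S) (r : S ⟶ S') (he : e ≫ r = 𝟙 S') {i : ℤ}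
    (h : Van S Y i) : Van S' Y i := fun f => by
  rw [← Category.id_comp f, ← he, Category.assoc, h (r ≫ f), comp_zero]

lemma Van.of_iso_left {S S' Y : C} (e : S ≅ S') {i : ℤ} (h : Van S Y i) : Van S' Y i :=
  h.of_retract_left e.inv e.hom e.inv_hom_id

lemma Van.of_shift_left {S Y : C} {a i j : ℤ} (hij : j + a = i) (h : Van S Y j) :
    Van (S⟦a⟧) Y i := fun f => by
  let e : Y⟦i⟧ ≅ (Y⟦j⟧)⟦a⟧ := (shiftFunctorAdd' C j a i hij).app Y
  obtain ⟨g, hg⟩ := (shiftFunctor C a).map_surjective (f ≫ e.hom)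
  rw [h g, Functor.map_zero] at hg
  rw [← cancel_mono e.hom, ← hg, zero_comp]

lemma Van.of_shift_right {S Y : C} {a i j : ℤ} (hij : a + i = j) (h : Van S Y j) :
    Van S (Y⟦a⟧) i := fun f => by
  let e : Y⟦j⟧ ≅ (Y⟦a⟧)⟦i⟧ := (shiftFunctorAdd' C a i j hij).app Y
  rw [← cancel_mono e.inv, h (f ≫ e.inv), zero_comp]

section

variable {T : Triangle C} (hT : T ∈ distTriang C) {Y : C}

include hT

lemma van_left_obj₂ {i : ℤ} (h₁ : Van T.obj₁ Y i) (h₃ : Van T.obj₃ Y i) : Van T.obj₂ Y i :=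
  fun f => by
    obtain ⟨g, rfl⟩ := T.yoneda_exact₂ hT f (h₁ _)
    rw [h₃ g, comp_zero]

lemma van_left_obj₃ {n₀ n₁ : ℤ} (h : n₀ + 1 = n₁) (h₁ : Van T.obj₁ Y n₀)
    (h₂ : Van T.obj₂ Y n₁) : Van T.obj₃ Y n₁ := fun f => by
  obtain ⟨g, rfl⟩ := T.yoneda_exact₃ hT f (h₂ _)
  rw [h₁.of_shift_left h g, comp_zero]

lemma van_left_obj₁ {n₀ n₁ : ℤ} (h : n₀ + 1 = n₁) (h₂ : Van T.obj₂ Y n₀)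
    (h₃ : Van T.obj₃ Y n₁) : Van T.obj₁ Y n₀ := by
  refine van_left_obj₂ (inv_rot_of_distTriang _ hT) (h₃.of_shift_left (a := -1) (by lia)) h₂

end

end Triangulated

section Noetherian

variable {R : Type u} [Ring R]

lemma isNoetherian_middle {X Y Z : ModuleCat.{v} R} {f : X ⟶ Y} {g : Y ⟶ Z} {w : f ≫ g = 0}
    (hex : (ShortComplex.mk f g w).Exact) (hX : IsNoetherian R X) (hZ : IsNoetherian R Z) :
    IsNoetherian R Y := by
  refine isNoetherian_of_range_eq_ker f.hom g.hom ?_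
  exact (ShortComplex.moduleCat_exact_iff_range_eq_ker _).1 hex

lemma isNoetherian_of_isZero {X : ModuleCat.{v} R} (hX : IsZero X) : IsNoetherian R X := by
  have := ModuleCat.subsingleton_of_isZero hX
  infer_instance

lemma isNoetherian_of_iso {X Y : ModuleCat.{v} R} (e : X ≅ Y) (hX : IsNoetherian R X) :
    IsNoetherian R Y :=
  isNoetherian_of_linearEquiv e.toLinearEquiv

end Noetherian

section AdditiveClosure

lemma isZero_biproduct {D : Type u} [Category.{v} D] [Preadditive D] {n : ℕ} (f : Fin n → D)
    [HasBiproduct f] (hf : ∀ i, IsZero (f i)) : IsZero (⨁ f) := by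
  rw [IsZero.iff_id_eq_zero, ← biproduct.total]
  exact Finset.sum_eq_zero (fun j _ => by rw [(hf j).eq_of_tgt (biproduct.π f j) 0, zero_comp])

lemma isNoetherian_biproduct {R : Type*} [Ring R] {n : ℕ} (f : Fin n → ModuleCat.{v} R)
    (hf : ∀ i, IsNoetherian R (f i)) : IsNoetherian R (⨁ f : ModuleCat.{v} R) :=
  isNoetherian_of_linearEquiv (ModuleCat.biproductIsoPi f).toLinearEquiv.symm

variable {C : Type u} [Category.{v} C] [HasZeroObject C] [Preadditive C] [HasShift C ℤ]
  [∀ n : ℤ, (shiftFunctor C n).Additive] [Pretriangulated C]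

lemma biproduct_mem_addOf (p : C) (n : ℕ) : (⨁ (fun _ : Fin n => p)) ∈ addOf p :=
  ⟨n, 𝟙 _, 𝟙 _, Category.comp_id _⟩

lemma exists_retract_of_mem_addOf {p K : C} (hK : K ∈ addOf p) {D : Type*} [Category* D]
    [Preadditive D] [HasFiniteBiproducts D] (F : C ⥤ D) [F.Additive] :
    ∃ n : ℕ, Nonempty (Retract (F.obj K) (⨁ (fun _ : Fin n => F.obj p))) := by
  obtain ⟨n, i, r, h⟩ := hK
  let e := F.mapBiproduct (fun _ : Fin n => p)
  exact ⟨n, ⟨⟨F.map i ≫ e.hom, e.inv ≫ F.map r, by simp [← F.map_comp, h]⟩⟩⟩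

lemma hasProjectiveDimensionLT_of_mem_addOf {p K : C} (hK : K ∈ addOf p) {D : Type*}
    [Category* D] [Abelian D] (F : C ⥤ D) [F.Additive] (n : ℕ)
    (h : HasProjectiveDimensionLT (F.obj p) n) : HasProjectiveDimensionLT (F.obj K) n := by
  have : HasFiniteBiproducts D := HasFiniteBiproducts.of_hasFiniteProducts
  obtain ⟨m, ⟨r⟩⟩ := exists_retract_of_mem_addOf hK F
  have := hasProjectiveDimensionLT_biproduct (fun _ : Fin m => F.obj p) n (fun _ => h)
  exact r.hasProjectiveDimensionLT n

lemma isNoetherian_of_mem_addOf {p K : C} (hK : K ∈ addOf p) {R : Type*} [Ring R]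
    (F : C ⥤ ModuleCat.{w} R) [F.Additive] (h : IsNoetherian R (F.obj p)) :
    IsNoetherian R (F.obj K) := by
  obtain ⟨m, ⟨r⟩⟩ := exists_retract_of_mem_addOf hK F
  have := isNoetherian_biproduct (fun _ : Fin m => F.obj p) (fun _ => h)
  have : Mono r.i := inferInstance
  exact isNoetherian_of_injective r.i.hom ((ModuleCat.mono_iff_injective _).1 this)

lemma van_of_mem_addOf {p K S : C} (hK : K ∈ addOf p) {i : ℤ} (h : Van S p i) : Van S K i := by
  rw [van_iff_isZero] at *
  obtain ⟨m, ⟨r⟩⟩ := exists_retract_of_mem_addOf hK (homShift S i)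
  have := isZero_biproduct (fun _ : Fin m => (homShift S i).obj p) (fun _ => h)
  rw [IsZero.iff_id_eq_zero, ← r.retract, this.eq_of_tgt r.i 0, zero_comp]

end AdditiveClosure

section Approximation

variable {C : Type u} [Category.{v} C] [HasZeroObject C] [Preadditive C] [HasShift C ℤ]
  [∀ n : ℤ, (shiftFunctor C n).Additive] [Pretriangulated C]

lemma epi_homShift_zero_map_iff (p : C) {X Y : C} (g : X ⟶ Y) :
    Epi ((homShift p 0).map g) ↔ ∀ f : p ⟶ Y, ∃ f' : p ⟶ X, f' ≫ g = f := by
  have := (MorphismProperty.epimorphisms _).arrow_mk_iso_iff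
    (Arrow.isoOfNatIso ((homFunctor p).isoShiftZero ℤ) (Arrow.mk g))
  refine Iff.trans this ?_
  rw [MorphismProperty.epimorphisms.iff, ModuleCat.epi_iff_surjective]
  rfl

/-- The right `End p`-module `End p` is free. -/
def linearEquivHomFunctorObj (p : C) : (End p)ᵐᵒᵖ ≃ₗ[(End p)ᵐᵒᵖ] (homFunctor p).obj p where
  toFun b := b.unop
  invFun f := MulOpposite.op f
  map_add' _ _ := rfl
  map_smul' _ _ := rfl
  left_inv _ := rfl
  right_inv _ := rfl

lemma projective_homShift_zero (p : C) : Projective ((homShift p 0).obj p) := by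
  refine Projective.of_iso (((homFunctor p).isoShiftZero ℤ).app p).symm ?_
  have : Module.Projective (End p)ᵐᵒᵖ ((homFunctor p).obj p) :=
    Module.Projective.of_equiv (linearEquivHomFunctorObj p)
  exact (IsProjective.iff_projective _).1 this

/-- The objects `Y` which are right orthogonal to the negative shifts of `p`, and such that all
`Hom(p, Y⟦i⟧)` are Noetherian. -/
structure Conn (p Y : C) : Prop where
  van : ∀ i : ℤ, 0 < i → Van p Y i
  noeth : ∀ i : ℤ, IsNoetherian (End p)ᵐᵒᵖ ((homShift p i).obj Y)

lemma Conn.of_mem_addOf {p K : C} (hp : Conn p p) (hK : K ∈ addOf p) : Conn p K where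
  van i hi := van_of_mem_addOf hK (hp.van i hi)
  noeth i := isNoetherian_of_mem_addOf hK (homShift p i) (hp.noeth i)

lemma noeth_obj₁ {T : Triangle C} (hT : T ∈ distTriang C) {p : C} {n₀ n₁ : ℤ} (h : n₀ + 1 = n₁)
    (h₃ : IsNoetherian (End p)ᵐᵒᵖ ((homShift p n₀).obj T.obj₃))
    (h₂ : IsNoetherian (End p)ᵐᵒᵖ ((homShift p n₁).obj T.obj₂)) :
    IsNoetherian (End p)ᵐᵒᵖ ((homShift p n₁).obj T.obj₁) :=
  isNoetherian_middle ((homFunctor p).homologySequence_exact₁ T hT n₀ n₁ h) h₃ h₂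

lemma Conn.obj₁ {T : Triangle C} (hT : T ∈ distTriang C) {p : C} (h₂ : Conn p T.obj₂)
    (h₃ : Conn p T.obj₃) (he : Epi ((homShift p 0).map T.mor₂)) : Conn p T.obj₁ where
  van i hi := by
    obtain rfl | hi := eq_or_lt_of_le (show 1 ≤ i by lia)
    · have h₀ : (homFunctor p).homologySequenceδ T 0 1 rfl = 0 :=
        ((homFunctor p).homologySequence_epi_shift_map_mor₂_iff T hT 0 1 rfl).1 he
      rw [van_iff_isZero]
      exact ((homFunctor p).homologySequence_exact₁ T hT 0 1 rfl).isZero_of_both_zeros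
        h₀ (((van_iff_isZero _ _ _).1 (h₂.van 1 hi)).eq_of_tgt _ _)
    · exact van_obj₁ hT (sub_add_cancel i 1) (h₃.van _ (by lia)) (h₂.van _ (by lia))
  noeth i := noeth_obj₁ hT (sub_add_cancel i 1) (h₃.noeth _) (h₂.noeth _)

lemma exists_generators {p Y : C} (h : IsNoetherian (End p)ᵐᵒᵖ ((homShift p 0).obj Y)) :
    ∃ (n : ℕ) (s : Fin n → (p ⟶ Y)), ∀ f : p ⟶ Y, ∃ c : Fin n → (p ⟶ p), ∑ i, c i ≫ s i = f := by
  have : IsNoetherian (End p)ᵐᵒᵖ ((homFunctor p).obj Y) :=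
    isNoetherian_of_iso (((homFunctor p).isoShiftZero ℤ).app Y) h
  obtain ⟨n, s, hs⟩ := Module.Finite.exists_fin (R := (End p)ᵐᵒᵖ) (M := (homFunctor p).obj Y)
  have hspan (x : (homFunctor p).obj Y) : ∃ c : Fin n → (End p)ᵐᵒᵖ, ∑ i, c i • s i = x :=
    (Submodule.mem_span_range_iff_exists_fun _).1 (hs ▸ Submodule.mem_top)
  refine ⟨n, s, fun f => ?_⟩
  obtain ⟨c, hc⟩ := hspan f
  exact ⟨fun i => (c i).unop, hc⟩

lemma exists_approximation {p Y : C} (hp : Conn p p) (hY : Conn p Y) :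
    ∃ (n : ℕ) (L : C) (f : L ⟶ ⨁ (fun _ : Fin n => p)) (g : (⨁ (fun _ : Fin n => p)) ⟶ Y)
      (h : Y ⟶ L⟦(1 : ℤ)⟧), Triangle.mk f g h ∈ distTriang C ∧
        Epi ((homShift p 0).map g) ∧ Conn p L := by
  obtain ⟨n, s, hs⟩ := exists_generators (hY.noeth 0)
  let g : (⨁ (fun _ : Fin n => p)) ⟶ Y := biproduct.desc s
  have hg : Epi ((homShift p 0).map g) := by
    rw [epi_homShift_zero_map_iff]
    intro f
    obtain ⟨c, rfl⟩ := hs f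
    exact ⟨biproduct.lift c, biproduct.lift_desc⟩
  obtain ⟨L, f, h, hT⟩ := distinguished_cocone_triangle₁ g
  exact ⟨n, L, f, g, h, hT, hg, Conn.obj₁ hT (hp.of_mem_addOf (biproduct_mem_addOf p n)) hY hg⟩

lemma mem_addOf_of_van {p K : C} (hp : Conn p p) (hK : Conn p K)
    (h : ∀ Y, Conn p Y → Van K Y 1) : K ∈ addOf p := by
  obtain ⟨n, L, f, g, δ, hT, _, hL⟩ := exists_approximation hp hK
  obtain ⟨s, hs⟩ := Triangle.coyoneda_exact₃ _ hT (𝟙 K) (h L hL _)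
  exact ⟨n, s, g, hs.symm⟩

lemma van_of_thick {p S : C} (hp : Conn p p)
    (hS : ∀ 𝒮 : Set C, IsThick 𝒮 → p ∈ 𝒮 → S ∈ 𝒮) (h : ∀ i : ℤ, 0 < i → Van S p i)
    {Y : C} (hY : Conn p Y) (i : ℤ) (hi : 0 < i) : Van S Y i := by
  obtain ⟨N, hN⟩ : ∃ N : ℤ, ∀ Y, Conn p Y → ∀ i ≥ N, Van S Y i := by
    refine hS {S | ∃ N : ℤ, ∀ Y, Conn p Y → ∀ i ≥ N, Van S Y i} ⟨?_, ?_, ?_, ?_⟩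
      ⟨1, fun Y hY i hi => hY.van i (by lia)⟩
    · rintro X Y e ⟨N, hN⟩
      exact ⟨N, fun Z hZ i hi => (hN Z hZ i hi).of_iso_left e⟩
    · rintro X n ⟨N, hN⟩
      exact ⟨N + n, fun Z hZ i hi => (hN Z hZ (i - n) (by lia)).of_shift_left (by lia)⟩
    · rintro T hT ⟨N₁, hN₁⟩ ⟨N₃, hN₃⟩
      exact ⟨max N₁ N₃, fun Z hZ i hi =>
        van_left_obj₂ hT (hN₁ Z hZ i (by lia)) (hN₃ Z hZ i (by lia))⟩
    · rintro X Y e r he ⟨N, hN⟩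
      exact ⟨N, fun Z hZ i hi => (hN Z hZ i hi).of_retract_left e r he⟩
  obtain ⟨k, hk⟩ : ∃ k : ℕ, N ≤ i + k := ⟨(N - i).toNat, by lia⟩
  induction k generalizing Y i with
  | zero => exact hN Y hY i (by lia)
  | succ k ih =>
    obtain ⟨n, L, f, g, δ, hT, _, hL⟩ := exists_approximation hp hY
    exact van_obj₃ hT rfl (van_of_mem_addOf (biproduct_mem_addOf p n) (h i hi))
      (ih hL (i + 1) (by lia) (by lia))

end Approximation

section Linear

/-- The `k`-subspace of `p ⟶ X` underlying a right `End p`-submodule. -/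
def subspaceOfSubmodule (k : Type*) [Field k] {C : Type u} [Category.{v} C] [Preadditive C]
    [Linear k C] {p X : C} (N : Submodule (End p)ᵐᵒᵖ (p ⟶ X)) : Submodule k (p ⟶ X) where
  carrier := N
  add_mem' := N.add_mem
  zero_mem' := N.zero_mem
  smul_mem' c f hf := by
    let b : (End p)ᵐᵒᵖ := MulOpposite.op (c • 𝟙 p)
    have : c • f = b • f := by
      change c • f = (c • 𝟙 p) ≫ f
      simp
    rw [this]
    exact N.smul_mem _ hf

lemma isNoetherian_hom (k : Type*) [Field k] {C : Type u} [Category.{v} C] [Preadditive C]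
    [Linear k C] (p X : C) [Module.Finite k (p ⟶ X)] : IsNoetherian (End p)ᵐᵒᵖ (p ⟶ X) := by
  rw [isNoetherian_iff']
  let φ : Submodule (End p)ᵐᵒᵖ (p ⟶ X) ↪o Submodule k (p ⟶ X) :=
    OrderEmbedding.ofMapLEIff (subspaceOfSubmodule k) (fun _ _ => Iff.rfl)
  exact φ.wellFoundedGT

end Linear

section Derived

open DerivedCategory

variable {C : Type u} [Category.{v} C] [Abelian C] [HasDerivedCategory.{w} C]

lemma Q_map_surjective (K L : CochainComplex C ℤ) [K.IsKProjective]
    (f : Q.obj K ⟶ Q.obj L) : ∃ g : K ⟶ L, Q.map g = f := by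
  obtain ⟨g, hg⟩ := (CochainComplex.IsKProjective.Qh_map_bijective K _).surjective
    ((quotientCompQhIso C).hom.app K ≫ f ≫ (quotientCompQhIso C).inv.app L)
  obtain ⟨g, rfl⟩ := (HomotopyCategory.quotient _ _).map_surjective g
  refine ⟨g, ?_⟩
  have h := (quotientCompQhIso C).hom.naturality g
  dsimp at h hg
  rw [hg] at h
  simpa using h.symm

lemma eq_zero_of_isLE {K : CochainComplex C ℤ} (hK : ∀ i, Projective (K.X i)) {a b n : ℤ}
    (ha : ∀ i < a, IsZero (K.X i)) (hb : ∀ i > b, IsZero (K.X i)) (hn : n < a)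
    {Z : DerivedCategory C} (hZ : Z.IsLE n) (f : Q.obj K ⟶ Z) : f = 0 := by
  have : K.IsStrictlyLE b := (K.isStrictlyLE_iff b).2 hb
  have := CochainComplex.isKProjective_of_projective K b
  obtain ⟨L, hL, ⟨e⟩⟩ := Z.exists_iso_Q_obj_of_isLE n
  obtain ⟨g, hg⟩ := Q_map_surjective K L (f ≫ e.hom)
  have h₀ : g = 0 := by
    ext i
    by_cases hi : i < a
    · exact (ha i hi).eq_of_src _ _
    · exact (L.isZero_of_isStrictlyLE n i (by lia)).eq_of_tgt _ _
  rw [← cancel_mono e.hom, ← hg, h₀, Functor.map_zero, zero_comp]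

lemma van_of_isLE {K : CochainComplex C ℤ} (hK : ∀ i, Projective (K.X i)) {a b n : ℤ}
    (ha : ∀ i < a, IsZero (K.X i)) (hb : ∀ i > b, IsZero (K.X i))
    {Z : DerivedCategory C} (hZ : Z.IsLE n) {i : ℤ} (hi : n - a < i) : Van (Q.obj K) Z i :=
  eq_zero_of_isLE hK ha hb (by lia) (TStructure.t.isLE_shift Z n i (n - i))

lemma van_of_isLE_of_isGE {X Y : DerivedCategory C} {n m i : ℤ} (hX : X.IsLE n) (hY : Y.IsGE m)
    (hi : n + i < m) : Van X Y i := fun f => by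
  have := TStructure.t.isGE_shift Y m i (m - i)
  exact TStructure.t.zero f n (m - i)

lemma isZero_homologyFunctor_of_isLE {X : DerivedCategory C} {n : ℤ} (hX : X.IsLE n) {i : ℤ}
    (hi : n < i) : IsZero ((homologyFunctor C i).obj X) :=
  X.isZero_of_isLE n i hi

lemma isLE_obj₃ {T : Triangle (DerivedCategory C)} (hT : T ∈ distTriang (DerivedCategory C))
    {n m : ℤ} (hnm : n + 1 = m) (h₂ : T.obj₂.IsLE n) (h₁ : T.obj₁.IsLE m) : T.obj₃.IsLE n := by
  rw [isLE_iff]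
  intro i hi
  exact ((homologyFunctor C 0).homologySequence_exact₃ T hT i (i + 1) rfl).isZero_of_both_zeros
    ((isZero_homologyFunctor_of_isLE h₂ hi).eq_of_src _ _)
    ((isZero_homologyFunctor_of_isLE h₁ (by lia)).eq_of_tgt _ _)

end Derived

section FiniteDimensional

open DerivedCategory ModuleCat

variable (k : Type) {R : Type} [Field k] [Ring R] [Algebra k R] [FiniteDimensional k R]

include k in
lemma finite_moduleCat_hom (M N : ModuleCat.{0} R) [Module.Finite R M] [Module.Finite R N] :
    Module.Finite k (M ⟶ N) := by
  have := Module.Finite.trans (R := k) R M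
  have := Module.Finite.trans (R := k) R N
  let φ : (M ⟶ N) →ₗ[k] (M →ₗ[k] N) :=
    { toFun f := f.hom.restrictScalars k
      map_add' _ _ := rfl
      map_smul' _ _ := rfl }
  refine Module.Finite.of_injective φ (fun f g h => ?_)
  ext x
  exact DFunLike.congr_fun h x

variable [HasDerivedCategory.{w} (ModuleCat.{0} R)]

lemma finite_derivedCategory_hom {P K : CochainComplex (ModuleCat.{0} R) ℤ}
    (hP : IsTwoTermCplx R P) (hK : ∀ i, Module.Finite R (K.X i)) :
    Module.Finite k (Q.obj P ⟶ Q.obj K) := by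
  obtain ⟨hP₁, hP₂, hP₃⟩ := hP
  have : P.IsStrictlyLE 0 := (P.isStrictlyLE_iff 0).2 (fun i hi => hP₃ i (by lia) (by lia))
  have := CochainComplex.isKProjective_of_projective P 0
  let φ : (P ⟶ K) →ₗ[k] ((P.X (-1) ⟶ K.X (-1)) × (P.X 0 ⟶ K.X 0)) :=
    { toFun f := (f.f (-1), f.f 0)
      map_add' _ _ := rfl
      map_smul' _ _ := rfl }
  have hφ : Function.Injective φ := fun f g h => by
    rw [Prod.ext_iff] at h
    ext i : 1
    by_cases hi : i = -1
    · subst hi; exact h.1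
    · by_cases hi' : i = 0
      · subst hi'; exact h.2
      · exact (hP₃ i hi hi').eq_of_src _ _
  have := finite_moduleCat_hom k (P.X (-1)) (K.X (-1))
  have := finite_moduleCat_hom k (P.X 0) (K.X 0)
  have := Module.Finite.of_injective φ hφ
  exact Module.Finite.of_surjective (Functor.mapLinearMap k Q (X := P) (Y := K))
    (Q_map_surjective P K)

include k in
lemma noeth_Q_obj {P K : CochainComplex (ModuleCat.{0} R) ℤ}
    (hP : IsTwoTermCplx R P) (hK : ∀ i, Module.Finite R (K.X i)) (i : ℤ) :
    IsNoetherian (End (Q.obj P))ᵐᵒᵖ ((homShift (Q.obj P) i).obj (Q.obj K)) := by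
  have := finite_derivedCategory_hom k hP (K := K⟦i⟧) (fun j => hK (j + i))
  have h : IsNoetherian (End (Q.obj P))ᵐᵒᵖ ((homFunctor (Q.obj P)).obj (Q.obj (K⟦i⟧))) :=
    isNoetherian_hom k (Q.obj P) (Q.obj (K⟦i⟧))
  exact isNoetherian_of_iso ((homFunctor (Q.obj P)).mapIso ((Q.commShiftIso i).app K)) h

end FiniteDimensional

section Single

open DerivedCategory

variable {R : Type} [Ring R] [HasDerivedCategory.{w} (ModuleCat.{0} R)]

/-- A module considered as an object of the derived category, in degree `0`. -/
abbrev single : ModuleCat.{0} R ⥤ DerivedCategory (ModuleCat.{0} R) :=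
  singleFunctor (ModuleCat.{0} R) 0

/-- The object of the derived category attached to a module is represented by a complex
concentrated in degree `0`. -/
def singleIso (M : ModuleCat.{0} R) :
    single.obj M ≅ Q.obj ((CochainComplex.singleFunctor (ModuleCat.{0} R) 0).obj M) :=
  (singleFunctorIsoCompQ _ 0).app M

lemma isZero_single_X (M : ModuleCat.{0} R) (i : ℤ) (hi : i ≠ 0) :
    IsZero (((CochainComplex.singleFunctor (ModuleCat.{0} R) 0).obj M).X i) :=
  HomologicalComplex.isZero_single_obj_X _ _ _ _ hi

/-- The component in degree `0` of a single complex. -/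
def singleXIso (M : ModuleCat.{0} R) :
    ((CochainComplex.singleFunctor (ModuleCat.{0} R) 0).obj M).X 0 ≅ M :=
  HomologicalComplex.singleObjXSelf _ _ _

lemma finite_single_X (M : ModuleCat.{0} R) [Module.Finite R M] (i : ℤ) :
    Module.Finite R (((CochainComplex.singleFunctor (ModuleCat.{0} R) 0).obj M).X i) := by
  by_cases hi : i = 0
  · subst hi
    exact Module.Finite.equiv (singleXIso M).symm.toLinearEquiv
  · have := ModuleCat.subsingleton_of_isZero (isZero_single_X M i hi)
    infer_instance

lemma projective_single_X (M : ModuleCat.{0} R) [Projective M] (i : ℤ) :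
    Projective (((CochainComplex.singleFunctor (ModuleCat.{0} R) 0).obj M).X i) := by
  by_cases hi : i = 0
  · subst hi
    exact Projective.of_iso (singleXIso M).symm inferInstance
  · exact (isZero_single_X M i hi).projective

lemma isPerfCplx_single (M : ModuleCat.{0} R) [Module.Finite R M] [Projective M] :
    IsPerfCplx R ((CochainComplex.singleFunctor (ModuleCat.{0} R) 0).obj M) :=
  ⟨projective_single_X M, finite_single_X M, 0, 0, fun i hi => isZero_single_X M i (by lia)⟩

variable {P : CochainComplex (ModuleCat.{0} R) ℤ}

lemma IsTwoTermCplx.isLE (hP : IsTwoTermCplx R P) : (Q.obj P).IsLE 0 := by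
  have : P.IsStrictlyLE 0 := (P.isStrictlyLE_iff 0).2 (fun i hi => hP.2.2 i (by lia) (by lia))
  infer_instance

lemma IsTwoTermCplx.isGE (hP : IsTwoTermCplx R P) : (Q.obj P).IsGE (-1) := by
  have : P.IsStrictlyGE (-1) :=
    (P.isStrictlyGE_iff (-1)).2 (fun i hi => hP.2.2 i (by lia) (by lia))
  infer_instance

lemma IsTwoTermCplx.van (hP : IsTwoTermCplx R P) {Z : DerivedCategory (ModuleCat.{0} R)} {n : ℤ}
    (hZ : Z.IsLE n) {i : ℤ} (hi : n + 1 < i) : Van (Q.obj P) Z i :=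
  van_of_isLE hP.1 (a := -1) (b := 0) (fun i hi => hP.2.2 i (by lia) (by lia))
    (fun i hi => hP.2.2 i (by lia) (by lia)) hZ (by lia)

lemma IsTwoTermCplx.van_single (hP : IsTwoTermCplx R P) (M : ModuleCat.{0} R) {i : ℤ}
    (hi : 1 < i) : Van (Q.obj P) (single.obj M) i :=
  hP.van (n := 0) inferInstance hi

lemma IsTwoTermCplx.van_single_neg (hP : IsTwoTermCplx R P) (M : ModuleCat.{0} R) {i : ℤ}
    (hi : i < 0) : Van (Q.obj P) (single.obj M) i :=
  van_of_isLE_of_isGE hP.isLE (m := 0) inferInstance (by lia)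

section

variable (k : Type) [Field k] [Algebra k R] [FiniteDimensional k R]

include k

lemma IsTwoTermSilting.conn (hP : IsTwoTermSilting R P) : Conn (Q.obj P) (Q.obj P) where
  van i hi := by
    obtain rfl | hi := eq_or_lt_of_le (show 1 ≤ i by lia)
    · exact hP.2.1
    · exact hP.1.van hP.1.isLE hi
  noeth := noeth_Q_obj k hP.1 hP.1.2.1

lemma noeth_single (hP : IsTwoTermCplx R P) (M : ModuleCat.{0} R) [Module.Finite R M] (i : ℤ) :
    IsNoetherian (End (Q.obj P))ᵐᵒᵖ ((homShift (Q.obj P) i).obj (single.obj M)) :=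
  isNoetherian_of_iso ((homShift (Q.obj P) i).mapIso (singleIso M).symm)
    (noeth_Q_obj k hP (finite_single_X M) i)

lemma conn_single (hP : IsTwoTermCplx R P) (M : ModuleCat.{0} R) [Module.Finite R M]
    (h : Van (Q.obj P) (single.obj M) 1) : Conn (Q.obj P) (single.obj M) where
  van i hi := by
    obtain rfl | hi := eq_or_lt_of_le (show 1 ≤ i by lia)
    · exact h
    · exact hP.van_single M hi
  noeth := noeth_single k hP M

lemma conn_single_shift (hP : IsTwoTermCplx R P) (M : ModuleCat.{0} R) [Module.Finite R M] :
    Conn (Q.obj P) ((single.obj M)⟦(1 : ℤ)⟧) where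
  van i hi := (hP.van_single M (i := 1 + i) (by lia)).of_shift_right rfl
  noeth i := isNoetherian_of_iso
    (((homFunctor (Q.obj P)).shiftIso 1 i (1 + i) rfl).symm.app (single.obj M))
    (noeth_single k hP M (1 + i))

lemma van_single_projective (hP : IsTwoTermSilting R P) (M : ModuleCat.{0} R)
    [Module.Finite R M] [Projective M] {Y : DerivedCategory (ModuleCat.{0} R)}
    (hY : Conn (Q.obj P) Y) {i : ℤ} (hi : 0 < i) : Van (single.obj M) Y i := by
  refine van_of_thick (hP.conn k) (fun 𝒮 h𝒮 hp => ?_) (fun i hi => ?_) hY i hi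
  · exact h𝒮.1 (singleIso M).symm (hP.2.2 𝒮 h𝒮 hp _ (isPerfCplx_single M))
  · refine Van.of_iso_left (singleIso M).symm (van_of_isLE (projective_single_X M)
      (a := 0) (b := 0) (fun i hi => ?_) (fun i hi => ?_) hP.1.isLE (by lia))
    all_goals exact isZero_single_X M i (by lia)

end

end Single

section ProjectiveDimensionHom

variable {C : Type u} [Category.{v} C] [HasZeroObject C] [Preadditive C] [HasShift C ℤ]
  [∀ n : ℤ, (shiftFunctor C n).Additive] [Pretriangulated C]

lemma van_left_of_mem_addOf {p K Y : C} (hK : K ∈ addOf p) {i : ℤ} (h : Van p Y i) :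
    Van K Y i := by
  obtain ⟨n, e, r, he⟩ := hK
  refine Van.of_retract_left e r he (fun f => ?_)
  ext j
  rw [comp_zero, h (_ ≫ f)]

/-- If `Hom(Y, Z⟦2⟧)` vanishes for all `Z` with `Conn p Z`, then `Y` is the
cone of a morphism in the additive closure of `p`. -/
lemma exists_addOf_resolution {p Y : C} (hp : Conn p p) (hY : Conn p Y)
    (h : ∀ Z, Conn p Z → Van Y Z 2) :
    ∃ T : Triangle C, T ∈ distTriang C ∧ T.obj₁ ∈ addOf p ∧ T.obj₂ ∈ addOf p ∧ T.obj₃ = Y ∧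
      Epi ((homShift p 0).map T.mor₂) := by
  obtain ⟨n, L, f, g, δ, hT, he, hL⟩ := exists_approximation hp hY
  exact ⟨_, hT, mem_addOf_of_van hp hL (fun Z hZ => van_left_obj₁ hT (n₁ := 2) rfl
    (van_left_of_mem_addOf (biproduct_mem_addOf p n) (hZ.van 1 one_pos)) (h Z hZ)),
    biproduct_mem_addOf p n, rfl, he⟩

lemma hasProjectiveDimensionLT_homShift_zero_of_mem_addOf {p K : C} (hK : K ∈ addOf p) :
    HasProjectiveDimensionLT ((homShift p 0).obj K) 1 :=
  hasProjectiveDimensionLT_of_mem_addOf hK _ 1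
    (projective_iff_hasProjectiveDimensionLT_one.1 (projective_homShift_zero p))

lemma hasProjectiveDimensionLT_two_of_van {p Y : C} (hp : Conn p p) (hY : Conn p Y)
    (h : ∀ Z, Conn p Z → Van Y Z 2) (h' : Van p Y (-1)) :
    HasProjectiveDimensionLT ((homShift p 0).obj Y) 2 := by
  obtain ⟨T, hT, h₁, h₂, rfl, he⟩ := exists_addOf_resolution hp hY h
  have hS : (ShortComplex.mk _ _ ((homFunctor p).homologySequence_comp T hT 0)).ShortExact :=
    { exact := (homFunctor p).homologySequence_exact₂ T hT 0
      mono_f := ((homFunctor p).homologySequence_mono_shift_map_mor₁_iff T hT (-1) 0 rfl).2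
        (((van_iff_isZero _ _ _).1 h').eq_of_src _ _)
      epi_g := he }
  have := hasProjectiveDimensionLT_homShift_zero_of_mem_addOf h₂
  exact hS.hasProjectiveDimensionLT_X₃ 1 (hasProjectiveDimensionLT_homShift_zero_of_mem_addOf h₁)
    (hasProjectiveDimensionLT_of_ge _ 1 2 (by lia))

lemma hasProjectiveDimensionLT_six_of_van {p Y : C} (hp : Conn p p) (hY : Conn p Y)
    (h : ∀ Z, Conn p Z → Van Y Z 2) (h' : Van p Y (-2))
    (hpd : HasProjectiveDimensionLT ((homShift p (-1)).obj p) 2)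
    (hpd' : HasProjectiveDimensionLT ((homShift p (-1)).obj Y) 2) :
    HasProjectiveDimensionLT ((homShift p 0).obj Y) 6 := by
  obtain ⟨T, hT, h₁, h₂, rfl, he⟩ := exists_addOf_resolution hp hY h
  have h₁' := hasProjectiveDimensionLT_homShift_zero_of_mem_addOf h₁
  have h₂' := hasProjectiveDimensionLT_homShift_zero_of_mem_addOf h₂
  exact hasProjectiveDimensionLT_last_of_sixTerm
    (((homFunctor p).homologySequence_mono_shift_map_mor₁_iff T hT (-2) (-1) rfl).2
        (((van_iff_isZero _ _ _).1 h').eq_of_src _ _))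
    ((homFunctor p).homologySequence_exact₂ T hT (-1))
    ((homFunctor p).homologySequence_exact₃ T hT (-1) 0 rfl)
    ((homFunctor p).homologySequence_exact₁ T hT (-1) 0 rfl)
    ((homFunctor p).homologySequence_exact₂ T hT 0) he 0
    (hasProjectiveDimensionLT_of_mem_addOf h₁ _ 2 hpd)
    (hasProjectiveDimensionLT_of_mem_addOf h₂ _ 2 hpd) hpd'
    (hasProjectiveDimensionLT_of_ge _ 1 5 (by lia))
    (hasProjectiveDimensionLT_of_ge _ 1 6 (by lia))

end ProjectiveDimensionHom

section ModuleResolution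

variable {R : Type} [Ring R] [IsNoetherianRing R]

lemma finite_obj₁ {S : ShortComplex (ModuleCat.{0} R)} (hS : S.ShortExact)
    [Module.Finite R S.X₂] : Module.Finite R S.X₁ :=
  Module.Finite.of_injective S.f.hom ((ModuleCat.mono_iff_injective _).1 hS.mono_f)

lemma finite_obj₃ {S : ShortComplex (ModuleCat.{0} R)} (hS : S.ShortExact)
    [Module.Finite R S.X₂] : Module.Finite R S.X₃ :=
  Module.Finite.of_surjective S.g.hom ((ModuleCat.epi_iff_surjective _).1 hS.epi_g)

lemma exists_projective_cover_sequence (M : ModuleCat.{0} R) [Module.Finite R M] :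
    ∃ S : ShortComplex (ModuleCat.{0} R), S.ShortExact ∧ S.X₃ = M ∧ Projective S.X₂ ∧
      Module.Finite R S.X₂ := by
  obtain ⟨n, f, hf⟩ := Module.Finite.exists_fin' R M
  let g : ModuleCat.of R (Fin n → R) ⟶ M := ModuleCat.ofHom f
  have : Epi g := (ModuleCat.epi_iff_surjective _).2 hf
  refine ⟨_, shortExact_kernel g, rfl, ?_, ?_⟩
  · exact (IsProjective.iff_projective (R := R) (Fin n → R)).1 inferInstance
  · exact inferInstanceAs (Module.Finite R (Fin n → R))

end ModuleResolution

section Truncation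

open DerivedCategory

variable {R : Type} [Ring R] [HasDerivedCategory.{w} (ModuleCat.{0} R)]

lemma isGE_obj₁ {T : Triangle (DerivedCategory (ModuleCat.{0} R))}
    (hT : T ∈ distTriang (DerivedCategory (ModuleCat.{0} R)))
    {n : ℤ} (h₂ : T.obj₂.IsGE n) (h₃ : T.obj₃.IsGE n) : T.obj₁.IsGE n := by
  rw [isGE_iff]
  intro i hi
  exact ((homologyFunctor _ 0).homologySequence_exact₁ T hT (i - 1) i (by lia)).isZero_of_both_zeros
    ((isZero_of_isGE T.obj₃ n (i - 1) (by lia)).eq_of_src _ _)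
    ((isZero_of_isGE T.obj₂ n i hi).eq_of_tgt _ _)

/-- The cohomology of `X` consists of noetherian modules. -/
def NoethHomology (X : DerivedCategory (ModuleCat.{0} R)) : Prop :=
  ∀ i : ℤ, IsNoetherian R ((homologyFunctor (ModuleCat.{0} R) i).obj X)

lemma NoethHomology.shift {X : DerivedCategory (ModuleCat.{0} R)} (hX : NoethHomology X) (n : ℤ) :
    NoethHomology (X⟦n⟧) := fun i =>
  isNoetherian_of_iso (((homologyFunctor (ModuleCat.{0} R) 0).shiftIso n i (n + i) rfl).symm.app X)
    (hX _)

lemma noethHomology_obj₁ {T : Triangle (DerivedCategory (ModuleCat.{0} R))}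
    (hT : T ∈ distTriang (DerivedCategory (ModuleCat.{0} R)))
    (h₂ : NoethHomology T.obj₂) (h₃ : NoethHomology T.obj₃) : NoethHomology T.obj₁ := fun i =>
  isNoetherian_middle ((homologyFunctor _ 0).homologySequence_exact₁ T hT (i - 1) i (by lia))
    (h₃ _) (h₂ _)

lemma noethHomology_obj₃ {T : Triangle (DerivedCategory (ModuleCat.{0} R))}
    (hT : T ∈ distTriang (DerivedCategory (ModuleCat.{0} R)))
    (h₁ : NoethHomology T.obj₁) (h₂ : NoethHomology T.obj₂) : NoethHomology T.obj₃ := fun i =>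
  isNoetherian_middle ((homologyFunctor _ 0).homologySequence_exact₃ T hT i (i + 1) rfl)
    (h₂ _) (h₁ _)

lemma noethHomology_single (M : ModuleCat.{0} R) (hM : IsNoetherian R M) :
    NoethHomology (single.obj M) := fun i => by
  obtain hi | rfl | hi := lt_trichotomy i 0
  · exact isNoetherian_of_isZero (isZero_of_isGE (single.obj M) 0 i hi)
  · exact isNoetherian_of_iso ((singleFunctorCompHomologyFunctorIso _ 0).symm.app M) hM
  · exact isNoetherian_of_isZero (isZero_of_isLE (single.obj M) 0 i hi)

lemma noethHomology_Q_obj [IsNoetherianRing R] {K : CochainComplex (ModuleCat.{0} R) ℤ}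
    (hK : ∀ i, Module.Finite R (K.X i)) : NoethHomology (Q.obj K) := fun i => by
  have h : IsNoetherian R (K.cycles i) := by
    have : IsNoetherian R (K.X i) := inferInstance
    exact isNoetherian_of_injective (K.iCycles i).hom ((ModuleCat.mono_iff_injective _).1 inferInstance)
  have : IsNoetherian R (K.homology i) :=
    isNoetherian_of_surjective (K.homologyπ i).hom
      (LinearMap.range_eq_top.2 ((ModuleCat.epi_iff_surjective _).1 inferInstance))
  exact isNoetherian_of_iso ((homologyFunctorFactors _ i).symm.app K) this

/-- The truncation triangle of an object of the derived category with no cohomology in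
positive degrees. -/
lemma exists_truncation {X : DerivedCategory (ModuleCat.{0} R)} (hX : X.IsLE 0) :
    ∃ (Y : DerivedCategory (ModuleCat.{0} R)) (M : ModuleCat.{0} R) (f : Y ⟶ X)
      (g : X ⟶ single.obj M) (h : single.obj M ⟶ Y⟦(1 : ℤ)⟧),
      Triangle.mk f g h ∈ distTriang (DerivedCategory (ModuleCat.{0} R)) ∧ Y.IsLE (-1) ∧
      Nonempty ((homologyFunctor (ModuleCat.{0} R) 0).obj X ≅ M) := by
  obtain ⟨Y, Z, hY, hZ, f, g, h, hT⟩ := TStructure.t.exists_triangle X (-1) 0 (by lia)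
  have hY' : Y.IsLE (-1) := ⟨hY⟩
  have hZ' : Z.IsGE 0 := ⟨hZ⟩
  have hZ'' : Z.IsLE 0 := isLE_obj₃ (n := 0) (m := 1) hT rfl hX (TStructure.t.isLE_of_le Y (-1) 1)
  obtain ⟨M, ⟨e⟩⟩ := Z.exists_iso_singleFunctor_obj_of_isGE_of_isLE 0
  have hT' : Triangle.mk f (g ≫ e.hom) (e.inv ≫ h) ∈ distTriang _ :=
    isomorphic_distinguished _ hT _ (Triangle.isoMk _ _ (Iso.refl Y) (Iso.refl X) e.symm
      (show f ≫ 𝟙 X = 𝟙 Y ≫ f by simp) (show (g ≫ e.hom) ≫ e.inv = 𝟙 X ≫ g by simp)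
      (show (e.inv ≫ h) ≫ (𝟙 Y)⟦(1 : ℤ)⟧' = e.inv ≫ h by simp))
  refine ⟨Y, M, _, _, _, hT', hY', ⟨?_ ≪≫ (singleFunctorCompHomologyFunctorIso _ 0).app M⟩⟩
  have h₁ : Mono ((homologyFunctor _ 0).map (g ≫ e.hom)) :=
    ((homologyFunctor _ 0).homologySequence_exact₂ _ hT' 0).mono_g
      ((isZero_of_isLE Y (-1) 0 (by lia)).eq_of_src _ _)
  have h₂ : Epi ((homologyFunctor _ 0).map (g ≫ e.hom)) :=
    ((homologyFunctor _ 0).homologySequence_exact₃ _ hT' 0 1 rfl).epi_f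
      ((isZero_of_isLE Y (-1) 1 (by lia)).eq_of_tgt _ _)
  have := isIso_of_mono_of_epi ((homologyFunctor _ 0).map (g ≫ e.hom))
  exact asIso ((homologyFunctor _ 0).map (g ≫ e.hom))

end Truncation

section Trace

open DerivedCategory

variable {R : Type} [Ring R] [HasDerivedCategory.{w} (ModuleCat.{0} R)]
  {P : CochainComplex (ModuleCat.{0} R) ℤ}

lemma van_single_biproduct {p : DerivedCategory (ModuleCat.{0} R)} {M : ModuleCat.{0} R} {i : ℤ}
    (h : Van p (single.obj M) i) (n : ℕ) : Van p (single.obj (⨁ (fun _ : Fin n => M))) i := by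
  rw [van_iff_isZero] at *
  exact (isZero_biproduct _ (fun _ => h)).of_iso
    ((single ⋙ homShift p i).mapBiproduct (fun _ : Fin n => M))

lemma IsTwoTermCplx.van_single_of_epi (hP : IsTwoTermCplx R P) {M N : ModuleCat.{0} R}
    (g : M ⟶ N) [Epi g] (h : Van (Q.obj P) (single.obj M) 1) :
    Van (Q.obj P) (single.obj N) 1 :=
  van_obj₃ (shortExact_kernel g).singleTriangle_distinguished (n₁ := 2) rfl h
    (hP.van_single _ (by lia))

lemma IsTwoTermCplx.mono_homShift_zero (hP : IsTwoTermCplx R P)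
    {S : ShortComplex (ModuleCat.{0} R)} (hS : S.ShortExact) :
    Mono ((homShift (Q.obj P) 0).map (single.map S.f)) :=
  ((homFunctor (Q.obj P)).homologySequence_mono_shift_map_mor₁_iff _
    hS.singleTriangle_distinguished (-1) 0 rfl).2
    (((van_iff_isZero _ _ _).1 (hP.van_single_neg S.X₃ (by lia))).eq_of_src _ _)

/-- The trace of `P` in the module `M`: the largest submodule of `M` which is generated
by `H⁰(P)`. -/
lemma exists_trace [IsNoetherianRing R] (hP : IsTwoTermSilting R P) (M : ModuleCat.{0} R)
    (hM : IsNoetherian (End (Q.obj P))ᵐᵒᵖ ((homShift (Q.obj P) 0).obj (single.obj M))) :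
    ∃ S : ShortComplex (ModuleCat.{0} R), S.ShortExact ∧ S.X₂ = M ∧
      IsIso ((homShift (Q.obj P) 0).map (single.map S.f)) ∧
      Van (Q.obj P) (single.obj S.X₁) 1 := by
  obtain ⟨X, C₀, f, π, δ, hT, hX, -⟩ := exists_truncation hP.1.isLE
  have hC₀ : Van (Q.obj P) (single.obj C₀) 1 :=
    van_obj₃ hT (n₀ := 1) (n₁ := 2) rfl hP.2.1 (hP.1.van hX (by lia))
  obtain ⟨n, s, hs⟩ := exists_generators hM
  have hc (j : Fin n) : ∃ c : C₀ ⟶ M, π ≫ single.map c = s j := by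
    obtain ⟨g, hg⟩ := Triangle.yoneda_exact₂ _ hT (s j)
      (TStructure.t.zero (X := X) (Y := single.obj M) _ (-1) 0)
    obtain ⟨c, rfl⟩ := single.map_surjective g
    exact ⟨c, hg.symm⟩
  choose c hc using hc
  let φ : (⨁ (fun _ : Fin n => C₀)) ⟶ M := biproduct.desc c
  have hS := shortExact_cokernel (image.ι φ)
  refine ⟨_, hS, rfl, ?_, hP.1.van_single_of_epi (factorThruImage φ) (van_single_biproduct hC₀ n)⟩
  have := hP.1.mono_homShift_zero hS
  have : Epi ((homShift (Q.obj P) 0).map (single.map (image.ι φ))) := by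
    rw [epi_homShift_zero_map_iff]
    intro f
    obtain ⟨b, rfl⟩ := hs f
    refine ⟨∑ i, b i ≫ π ≫ single.map (biproduct.ι (fun _ : Fin n => C₀) i ≫ factorThruImage φ), ?_⟩
    rw [Preadditive.sum_comp]
    refine Finset.sum_congr rfl (fun i _ => ?_)
    rw [Category.assoc, Category.assoc, ← single.map_comp, Category.assoc, image.fac,
      biproduct.ι_desc, hc]
  exact isIso_of_mono_of_epi _

end Trace

section GlobalDimensionTwo

open DerivedCategory

/-- The cohomology of a shifted object. -/
def homShiftObjShiftIso {C : Type u} [Category.{v} C] [HasZeroObject C] [Preadditive C]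
    [HasShift C ℤ] [∀ n : ℤ, (shiftFunctor C n).Additive] [Pretriangulated C] (p X : C)
    {n a b : ℤ} (h : n + a = b) : (homShift p a).obj (X⟦n⟧) ≅ (homShift p b).obj X :=
  ((homFunctor p).shiftIso n a b h).app X

variable (k : Type) {R : Type} [Field k] [Ring R] [Algebra k R] [FiniteDimensional k R]
  [IsNoetherianRing R] [HasDerivedCategory.{w} (ModuleCat.{0} R)]
  {P : CochainComplex (ModuleCat.{0} R) ℤ}

include k

lemma van_single_two (hP : IsTwoTermSilting R P) (M : ModuleCat.{0} R) [Module.Finite R M]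
    (hM : HasProjectiveDimensionLT M 2) (Z : DerivedCategory (ModuleCat.{0} R))
    (hZ : Conn (Q.obj P) Z) : Van (single.obj M) Z 2 := by
  obtain ⟨S, hS, rfl, h₁, h₂⟩ := exists_projective_cover_sequence M
  have := finite_obj₁ hS
  have : Projective S.X₁ := projective_iff_hasProjectiveDimensionLT_one.2
    (hS.hasProjectiveDimensionLT_X₁ 1 inferInstance hM)
  exact van_left_obj₃ hS.singleTriangle_distinguished (n₀ := 1) rfl
    (van_single_projective k hP _ hZ (by lia)) (van_single_projective k hP _ hZ (by lia))

lemma hasProjectiveDimensionLT_two_of_van_single (hP : IsTwoTermSilting R P)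
    (M : ModuleCat.{0} R) [Module.Finite R M] (hM : HasProjectiveDimensionLT M 2)
    (h : Van (Q.obj P) (single.obj M) 1) :
    HasProjectiveDimensionLT ((homShift (Q.obj P) 0).obj (single.obj M)) 2 :=
  hasProjectiveDimensionLT_two_of_van (hP.conn k) (conn_single k hP.1 M h)
    (van_single_two k hP M hM) (hP.1.van_single_neg M (by lia))

lemma hasProjectiveDimensionLT_two_of_mono (hP : IsTwoTermSilting R P)
    (hR : ∀ M : ModuleCat.{0} R, Module.Finite R M → HasProjectiveDimensionLT M 3)
    {M N : ModuleCat.{0} R} (f : M ⟶ N) [Mono f] [Module.Finite R N] [Projective N] :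
    HasProjectiveDimensionLT ((homShift (Q.obj P) 0).obj (single.obj M)) 2 := by
  have : Module.Finite R M := finite_obj₁ (shortExact_cokernel f)
  obtain ⟨S, hS, rfl, _, h⟩ := exists_trace hP M (noeth_single k hP.1 M 0)
  have := finite_obj₁ hS
  have := hS.mono_f
  have hT := shortExact_cokernel (S.f ≫ f)
  have := finite_obj₃ hT
  have := hasProjectiveDimensionLT_two_of_van_single k hP S.X₁
    (hT.hasProjectiveDimensionLT_X₁ 2 (hasProjectiveDimensionLT_of_ge N 1 2 (by lia))
      (hR _ inferInstance)) h
  exact hasProjectiveDimensionLT_of_iso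
    (asIso ((homShift (Q.obj P) 0).map (single.map S.f))) 2

lemma hasProjectiveDimensionLT_two_homShift_neg_one (hP : IsTwoTermSilting R P)
    (hR : ∀ M : ModuleCat.{0} R, Module.Finite R M → HasProjectiveDimensionLT M 3) :
    HasProjectiveDimensionLT ((homShift (Q.obj P) (-1)).obj (Q.obj P)) 2 := by
  obtain ⟨X, C₀, f, π, δ, hT, hX, -⟩ := exists_truncation hP.1.isLE
  have hX' : X.IsGE (-1) := isGE_obj₁ hT hP.1.isGE
    (TStructure.t.isGE_of_ge (single.obj C₀) (-1) 0)
  have := TStructure.t.isLE_shift X (-1) (-1) 0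
  have := TStructure.t.isGE_shift X (-1) (-1) 0
  obtain ⟨N, ⟨e⟩⟩ := (X⟦(-1 : ℤ)⟧).exists_iso_singleFunctor_obj_of_isGE_of_isLE 0
  have h₁ : Mono ((homShift (Q.obj P) (-1)).map f) :=
    ((homFunctor (Q.obj P)).homologySequence_mono_shift_map_mor₁_iff _ hT (-2) (-1) rfl).2
      (((van_iff_isZero _ _ _).1 (hP.1.van_single_neg C₀ (by lia))).eq_of_src _ _)
  have h₂ : Epi ((homShift (Q.obj P) (-1)).map f) :=
    ((homFunctor (Q.obj P)).homologySequence_epi_shift_map_mor₁_iff _ hT (-1)).2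
      (((van_iff_isZero _ _ _).1 (hP.1.van_single_neg C₀ (by lia))).eq_of_tgt _ _)
  have := isIso_of_mono_of_epi ((homShift (Q.obj P) (-1)).map f)
  let e₁ : (homShift (Q.obj P) 0).obj (single.obj N) ≅ (homShift (Q.obj P) (-1)).obj (Q.obj P) :=
    (homShift (Q.obj P) 0).mapIso e.symm ≪≫ homShiftObjShiftIso _ X (by lia) ≪≫
      asIso ((homShift (Q.obj P) (-1)).map f)
  let e' : (homologyFunctor (ModuleCat.{0} R) 0).obj (X⟦(-1 : ℤ)⟧) ≅
      (homologyFunctor (ModuleCat.{0} R) (-1)).obj X :=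
    ((homologyFunctor (ModuleCat.{0} R) 0).shiftIso (-1 : ℤ) 0 (-1) (by lia)).app X
  let e₂ : N ≅ (homologyFunctor (ModuleCat.{0} R) (-1)).obj X :=
    (singleFunctorCompHomologyFunctorIso _ 0).symm.app N ≪≫
      (homologyFunctor (ModuleCat.{0} R) 0).mapIso e.symm ≪≫ e'
  have h₃ : Mono ((homologyFunctor (ModuleCat.{0} R) (-1)).map f) :=
    ((homologyFunctor (ModuleCat.{0} R) 0).homologySequence_mono_shift_map_mor₁_iff _ hT
      (-2) (-1) rfl).2 ((isZero_of_isGE (single.obj C₀) 0 (-2) (by lia)).eq_of_src _ _)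
  let e₃ : P.cycles (-1) ≅ P.homology (-1) :=
    P.isoHomologyπ (-2) (-1) (by simp) ((hP.1.2.2 (-2) (by lia) (by lia)).eq_of_src _ _)
  have h₄ : Mono e₃.inv := inferInstance
  let g : N ⟶ P.X (-1) := e₂.hom ≫ (homologyFunctor (ModuleCat.{0} R) (-1)).map f ≫
    (homologyFunctorFactors _ (-1)).hom.app P ≫ e₃.inv ≫ P.iCycles (-1)
  have : Mono g := mono_comp' inferInstance (mono_comp' h₃ (mono_comp' inferInstance
    (mono_comp' h₄ inferInstance)))
  have := hP.1.1 (-1)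
  have := hP.1.2.1 (-1)
  have := hasProjectiveDimensionLT_two_of_mono k hP hR g
  exact hasProjectiveDimensionLT_of_iso e₁ 2

lemma hasProjectiveDimensionLT_six_of_projective (hP : IsTwoTermSilting R P)
    (hR : ∀ M : ModuleCat.{0} R, Module.Finite R M → HasProjectiveDimensionLT M 3)
    (M : ModuleCat.{0} R) [Module.Finite R M] [Projective M] :
    HasProjectiveDimensionLT ((homShift (Q.obj P) 1).obj (single.obj M)) 6 := by
  have h := hasProjectiveDimensionLT_two_of_mono k hP hR (𝟙 M)
  have := hasProjectiveDimensionLT_six_of_van (hP.conn k) (conn_single_shift k hP.1 M)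
    (fun Z hZ => (van_single_projective k hP M hZ one_pos).of_shift_left rfl)
    ((hP.1.van_single_neg M (i := -1) (by lia)).of_shift_right (by lia))
    (hasProjectiveDimensionLT_two_homShift_neg_one k hP hR)
    (hasProjectiveDimensionLT_of_iso
      (homShiftObjShiftIso (Q.obj P) (single.obj M) (n := 1) (a := -1) (b := 0) (by lia)).symm 2)
  exact hasProjectiveDimensionLT_of_iso
    (homShiftObjShiftIso (Q.obj P) (single.obj M) (n := 1) (a := 0) (b := 1) (by lia)) 6

lemma hasProjectiveDimensionLT_seven_of_mono (hP : IsTwoTermSilting R P)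
    (hR : ∀ M : ModuleCat.{0} R, Module.Finite R M → HasProjectiveDimensionLT M 3)
    {M N : ModuleCat.{0} R} (f : M ⟶ N) [Mono f] [Module.Finite R N] [Projective N] :
    HasProjectiveDimensionLT ((homShift (Q.obj P) 1).obj (single.obj M)) 7 := by
  have : Module.Finite R M := finite_obj₁ (shortExact_cokernel f)
  have : Module.Finite R ↑(cokernel f) := finite_obj₃ (shortExact_cokernel f)
  have hM : HasProjectiveDimensionLT M 2 := (shortExact_cokernel f).hasProjectiveDimensionLT_X₁ 2
    (hasProjectiveDimensionLT_of_ge N 1 2 (by lia)) (hR _ inferInstance)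
  obtain ⟨S, hS, rfl, _, _⟩ := exists_projective_cover_sequence M
  have := finite_obj₁ hS
  have : Projective S.X₁ := projective_iff_hasProjectiveDimensionLT_one.2
    (hS.hasProjectiveDimensionLT_X₁ 1 inferInstance hM)
  have hT := hS.singleTriangle_distinguished
  have h₂ : HasProjectiveDimensionLT ((homShift (Q.obj P) 1).obj (single.obj S.X₂)) 7 :=
    have := hasProjectiveDimensionLT_six_of_projective k hP hR S.X₂
    hasProjectiveDimensionLT_of_ge _ 6 7 (by lia)
  have := hasProjectiveDimensionLT_six_of_projective k hP hR S.X₁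
  exact hasProjectiveDimensionLT_last_of_sixTerm (hP.1.mono_homShift_zero hS)
    ((homFunctor (Q.obj P)).homologySequence_exact₂ _ hT 0)
    ((homFunctor (Q.obj P)).homologySequence_exact₃ _ hT 0 1 rfl)
    ((homFunctor (Q.obj P)).homologySequence_exact₁ _ hT 0 1 rfl)
    ((homFunctor (Q.obj P)).homologySequence_exact₂ _ hT 1)
    (((homFunctor (Q.obj P)).homologySequence_epi_shift_map_mor₂_iff _ hT 1 2 rfl).2
      (((van_iff_isZero _ _ _).1 (hP.1.van_single S.X₁ (by lia))).eq_of_tgt _ _)) 1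
    (hasProjectiveDimensionLT_two_of_mono k hP hR (𝟙 S.X₁))
    (hasProjectiveDimensionLT_two_of_mono k hP hR (𝟙 S.X₂))
    (hasProjectiveDimensionLT_two_of_mono k hP hR f)
    this h₂

lemma hasProjectiveDimensionLT_seven_of_van (hP : IsTwoTermSilting R P)
    (hR : ∀ M : ModuleCat.{0} R, Module.Finite R M → HasProjectiveDimensionLT M 3)
    (M : ModuleCat.{0} R) [Module.Finite R M] (h : Van (Q.obj P) (single.obj M) 1) :
    HasProjectiveDimensionLT ((homShift (Q.obj P) 0).obj (single.obj M)) 7 := by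
  obtain ⟨S, hS, rfl, _, _⟩ := exists_projective_cover_sequence M
  have hT := hS.singleTriangle_distinguished
  have h₂ : HasProjectiveDimensionLT ((homShift (Q.obj P) 1).obj (single.obj S.X₂)) 8 :=
    have := hasProjectiveDimensionLT_six_of_projective k hP hR S.X₂
    hasProjectiveDimensionLT_of_ge _ 6 8 (by lia)
  have := hS.mono_f
  exact hasProjectiveDimensionLT_middle_of_fiveTerm (hP.1.mono_homShift_zero hS)
    ((homFunctor (Q.obj P)).homologySequence_exact₂ _ hT 0)
    ((homFunctor (Q.obj P)).homologySequence_exact₃ _ hT 0 1 rfl)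
    ((homFunctor (Q.obj P)).homologySequence_exact₁ _ hT 0 1 rfl)
    (((homFunctor (Q.obj P)).homologySequence_epi_shift_map_mor₁_iff _ hT 1).2
      (((van_iff_isZero _ _ _).1 h).eq_of_tgt _ _)) 4
    (hasProjectiveDimensionLT_two_of_mono k hP hR S.f)
    (hasProjectiveDimensionLT_two_of_mono k hP hR (𝟙 S.X₂))
    (hasProjectiveDimensionLT_seven_of_mono k hP hR S.f) h₂

lemma hasProjectiveDimensionLT_seven (hP : IsTwoTermSilting R P)
    (hR : ∀ M : ModuleCat.{0} R, Module.Finite R M → HasProjectiveDimensionLT M 3)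
    (M : ModuleCat.{0} R) [Module.Finite R M] :
    HasProjectiveDimensionLT ((homShift (Q.obj P) 0).obj (single.obj M)) 7 := by
  obtain ⟨S', hS', rfl, _, h⟩ := exists_trace hP M (noeth_single k hP.1 M 0)
  have := finite_obj₁ hS'
  have := hasProjectiveDimensionLT_seven_of_van k hP hR S'.X₁ h
  exact hasProjectiveDimensionLT_of_iso (asIso ((homShift (Q.obj P) 0).map (single.map S'.f))) 7

lemma hasProjectiveDimensionLT_eight_of_van (hP : IsTwoTermSilting R P)
    (hR : ∀ M : ModuleCat.{0} R, Module.Finite R M → HasProjectiveDimensionLT M 3)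
    (M : ModuleCat.{0} R) [Module.Finite R M] (h : Van (Q.obj P) (single.obj M) 0) :
    HasProjectiveDimensionLT ((homShift (Q.obj P) 1).obj (single.obj M)) 8 := by
  obtain ⟨S, hS, rfl, _, _⟩ := exists_projective_cover_sequence M
  have hT := hS.singleTriangle_distinguished
  have h₂ : HasProjectiveDimensionLT ((homShift (Q.obj P) 1).obj (single.obj S.X₂)) 8 :=
    have := hasProjectiveDimensionLT_six_of_projective k hP hR S.X₂
    hasProjectiveDimensionLT_of_ge _ 6 8 (by lia)
  have := hS.mono_f
  have hS₁ : (ShortComplex.mk _ _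
      ((homFunctor (Q.obj P)).homologySequence_comp _ hT 1)).ShortExact :=
    { exact := (homFunctor (Q.obj P)).homologySequence_exact₂ _ hT 1
      mono_f := ((homFunctor (Q.obj P)).homologySequence_mono_shift_map_mor₁_iff _ hT 0 1 rfl).2
        (((van_iff_isZero _ _ _).1 h).eq_of_src _ _)
      epi_g := ((homFunctor (Q.obj P)).homologySequence_epi_shift_map_mor₂_iff _ hT 1 2 rfl).2
        (((van_iff_isZero _ _ _).1 (hP.1.van_single S.X₁ (by lia))).eq_of_tgt _ _) }
  exact hS₁.hasProjectiveDimensionLT_X₃ 7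
    (hasProjectiveDimensionLT_seven_of_mono k hP hR S.f) h₂

lemma hasProjectiveDimensionLT_eight (hP : IsTwoTermSilting R P)
    (hR : ∀ M : ModuleCat.{0} R, Module.Finite R M → HasProjectiveDimensionLT M 3)
    (M : ModuleCat.{0} R) [Module.Finite R M] :
    HasProjectiveDimensionLT ((homShift (Q.obj P) 1).obj (single.obj M)) 8 := by
  obtain ⟨S', hS', rfl, hf, h⟩ := exists_trace hP M (noeth_single k hP.1 M 0)
  have := finite_obj₃ hS'
  have hT' := hS'.singleTriangle_distinguished
  have h₁ : Mono ((homShift (Q.obj P) 1).map (single.map S'.g)) :=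
    ((homFunctor (Q.obj P)).homologySequence_mono_shift_map_mor₂_iff _ hT' 1).2
      (((van_iff_isZero _ _ _).1 h).eq_of_src _ _)
  have h₂ : Epi ((homShift (Q.obj P) 1).map (single.map S'.g)) :=
    ((homFunctor (Q.obj P)).homologySequence_epi_shift_map_mor₂_iff _ hT' 1 2 rfl).2
      (((van_iff_isZero _ _ _).1 (hP.1.van_single S'.X₁ (by lia))).eq_of_tgt _ _)
  have := isIso_of_mono_of_epi ((homShift (Q.obj P) 1).map (single.map S'.g))
  have h₀ : Van (Q.obj P) (single.obj S'.X₃) 0 := by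
    rw [van_iff_isZero]
    refine ((homFunctor (Q.obj P)).homologySequence_exact₃ _ hT' 0 1 rfl).isZero_of_both_zeros
      (((homFunctor (Q.obj P)).homologySequence_epi_shift_map_mor₁_iff _ hT' 0).1 ?_)
      (((van_iff_isZero _ _ _).1 h).eq_of_tgt _ _)
    change Epi ((homShift (Q.obj P) 0).map (single.map S'.f))
    infer_instance
  have := hasProjectiveDimensionLT_eight_of_van k hP hR S'.X₃ h₀
  exact hasProjectiveDimensionLT_of_iso
    (asIso ((homShift (Q.obj P) 1).map (single.map S'.g))).symm 8

end GlobalDimensionTwo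

section Presentation

variable {C : Type u} [Category.{v} C] [HasZeroObject C] [Preadditive C] [HasShift C ℤ]
  [∀ n : ℤ, (shiftFunctor C n).Additive] [Pretriangulated C]

/-- The morphism from a free right `End p`-module determined by a family of elements. -/
def homFunctorObjBiproductDesc (p : C) {V : ModuleCat.{v} (End p)ᵐᵒᵖ} {n : ℕ} (s : Fin n → V) :
    (homFunctor p).obj (⨁ (fun _ : Fin n => p)) ⟶ V :=
  ModuleCat.ofHom
    { toFun := fun f : p ⟶ ⨁ (fun _ : Fin n => p) =>
        ∑ i, (MulOpposite.op (f ≫ biproduct.π _ i) : (End p)ᵐᵒᵖ) • s i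
      map_add' := fun (f g : p ⟶ ⨁ (fun _ : Fin n => p)) => by
        change ∑ i, (MulOpposite.op ((f + g) ≫ biproduct.π _ i) : (End p)ᵐᵒᵖ) • s i = _
        rw [← Finset.sum_add_distrib]
        refine Finset.sum_congr rfl fun i _ => ?_
        rw [Preadditive.add_comp, ← add_smul]
        rfl
      map_smul' := fun b (f : p ⟶ ⨁ (fun _ : Fin n => p)) => by
        change ∑ i, (MulOpposite.op ((b.unop ≫ f) ≫ biproduct.π _ i) : (End p)ᵐᵒᵖ) • s i = _
        rw [RingHom.id_apply, Finset.smul_sum]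
        refine Finset.sum_congr rfl fun i _ => ?_
        rw [Category.assoc, smul_smul]
        rfl }

lemma homFunctorObjBiproductDesc_lift (p : C) {V : ModuleCat.{v} (End p)ᵐᵒᵖ} {n : ℕ}
    (s : Fin n → V) (c : Fin n → (End p)ᵐᵒᵖ) :
    (homFunctorObjBiproductDesc p s).hom
      (show p ⟶ _ from biproduct.lift fun i => (c i).unop) = ∑ i, c i • s i := by
  change ∑ i, (MulOpposite.op (biproduct.lift (fun i => (c i).unop) ≫ biproduct.π _ i) :
    (End p)ᵐᵒᵖ) • s i = _
  refine Finset.sum_congr rfl fun i _ => ?_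
  rw [biproduct.lift_π]
  rfl

lemma exists_presentation {p : C} (hp : IsNoetherian (End p)ᵐᵒᵖ ((homShift p 0).obj p))
    (V : ModuleCat.{v} (End p)ᵐᵒᵖ) [Module.Finite (End p)ᵐᵒᵖ V] :
    ∃ (m n : ℕ) (g : (⨁ (fun _ : Fin m => p)) ⟶ ⨁ (fun _ : Fin n => p))
      (π : (homShift p 0).obj (⨁ (fun _ : Fin n => p)) ⟶ V) (w : (homShift p 0).map g ≫ π = 0),
      Epi π ∧ (ShortComplex.mk _ π w).Exact := by
  obtain ⟨n, v, hv⟩ := Module.Finite.exists_fin (R := (End p)ᵐᵒᵖ) (M := V)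
  let q := ⨁ (fun _ : Fin n => p)
  let π : (homFunctor p).obj q ⟶ V := homFunctorObjBiproductDesc p v
  have hπ : Epi π := by
    rw [ModuleCat.epi_iff_surjective]
    intro x
    obtain ⟨c, hc⟩ := (Submodule.mem_span_range_iff_exists_fun (End p)ᵐᵒᵖ).1
      (hv ▸ Submodule.mem_top : x ∈ Submodule.span (End p)ᵐᵒᵖ (Set.range v))
    exact ⟨_, (homFunctorObjBiproductDesc_lift p v c).trans hc⟩
  let ε := (homFunctor p).isoShiftZero ℤ
  have : IsNoetherian (End p)ᵐᵒᵖ ((homFunctor p).obj q) :=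
    isNoetherian_of_iso (ε.app q)
      (isNoetherian_of_mem_addOf (biproduct_mem_addOf p n) (homShift p 0) hp)
  obtain ⟨m, s, hs⟩ := Submodule.fg_iff_exists_fin_generating_family.1
    (IsNoetherian.noetherian (LinearMap.ker π.hom))
  have hs' (f : p ⟶ q) : (show (homFunctor p).obj q from f) ∈ LinearMap.ker π.hom ↔
      ∃ c : Fin m → (End p)ᵐᵒᵖ, ∑ i, c i • s i = (show (homFunctor p).obj q from f) := by
    rw [← hs]
    exact Submodule.mem_span_range_iff_exists_fun _
  let s' : Fin m → (p ⟶ q) := s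
  let g : (⨁ (fun _ : Fin m => p)) ⟶ q := biproduct.desc s'
  have w : (homFunctor p).map g ≫ π = 0 := by
    ext (f : p ⟶ _)
    refine (hs' (f ≫ g)).2 ⟨fun i => MulOpposite.op (f ≫ biproduct.π _ i), ?_⟩
    change ∑ i, (f ≫ biproduct.π _ i) ≫ s' i = f ≫ g
    simp only [g, biproduct.desc_eq, Preadditive.comp_sum, Category.assoc]
  have hex : (ShortComplex.mk _ π w).Exact := by
    rw [ShortComplex.moduleCat_exact_iff]
    intro (f : p ⟶ q) hf
    obtain ⟨c, hc⟩ := (hs' f).1 hf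
    refine ⟨(show p ⟶ _ from biproduct.lift fun i => (c i).unop), ?_⟩
    exact (biproduct.lift_desc (g := fun i => (c i).unop) (h := s')).trans hc
  have w' : (homShift p 0).map g ≫ ε.hom.app q ≫ π = 0 := by
    rw [← Category.assoc, ε.hom.naturality g, Category.assoc, w, comp_zero]
  refine ⟨m, n, g, ε.hom.app q ≫ π, w', epi_comp _ _, ?_⟩
  exact ShortComplex.exact_of_iso (ShortComplex.isoMk (ε.symm.app _) (ε.symm.app _) (Iso.refl V)
    (ε.inv.naturality g).symm (by simp)) hex

lemma exists_triangle_homShift_zero {p : C} (hp : Conn p p)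
    (V : ModuleCat.{v} (End p)ᵐᵒᵖ) [Module.Finite (End p)ᵐᵒᵖ V] :
    ∃ T ∈ distTriang C, T.obj₁ ∈ addOf p ∧ T.obj₂ ∈ addOf p ∧
      Nonempty ((homShift p 0).obj T.obj₃ ≅ V) := by
  obtain ⟨m, n, g, π, w, hπ, hex⟩ := exists_presentation (hp.noeth 0) V
  obtain ⟨X, f, h, hT⟩ := distinguished_cocone_triangle g
  refine ⟨_, hT, biproduct_mem_addOf p m, biproduct_mem_addOf p n, ⟨?_⟩⟩
  have hf : Epi ((homShift p 0).map f) :=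
    ((homFunctor p).homologySequence_epi_shift_map_mor₂_iff _ hT 0 1 rfl).2
      (((van_iff_isZero _ _ _).1
        (van_of_mem_addOf (biproduct_mem_addOf p m) (hp.van 1 one_pos))).eq_of_tgt _ _)
  have hex' := (homFunctor p).homologySequence_exact₂ _ hT 0
  have : Epi (ShortComplex.mk _ _ ((homFunctor p).homologySequence_comp _ hT 0)).g := hf
  have : Epi (ShortComplex.mk _ π w).g := hπ
  exact IsColimit.coconePointUniqueUpToIso hex'.gIsCokernel hex.gIsCokernel

end Presentation

section Main

open DerivedCategory

variable (k : Type) {R : Type} [Field k] [Ring R] [Algebra k R] [FiniteDimensional k R]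
  [IsNoetherianRing R] [HasDerivedCategory.{w} (ModuleCat.{0} R)]
  {P : CochainComplex (ModuleCat.{0} R) ℤ}

include k

lemma hasProjectiveDimensionLT_eight_of_isLE (hP : IsTwoTermSilting R P)
    (hR : ∀ M : ModuleCat.{0} R, Module.Finite R M → HasProjectiveDimensionLT M 3)
    {X : DerivedCategory (ModuleCat.{0} R)} (hX : X.IsLE 0) (hX' : NoethHomology X) :
    HasProjectiveDimensionLT ((homShift (Q.obj P) 0).obj X) 8 := by
  obtain ⟨Y, M, f, g, h, hT, hY, ⟨e⟩⟩ := exists_truncation hX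
  have hM : IsNoetherian R M := isNoetherian_of_iso e (hX' 0)
  have hY' : NoethHomology Y := noethHomology_obj₁ hT hX' (noethHomology_single M hM)
  obtain ⟨Z, N, f', g', h', hT', hZ, ⟨e'⟩⟩ :=
    exists_truncation (TStructure.t.isLE_shift Y (-1) (-1) 0 (by lia))
  have hN : IsNoetherian R N := isNoetherian_of_iso e' (hY'.shift (-1) 0)
  have hZ₁ := (van_iff_isZero _ _ _).1 (hP.1.van hZ (i := 1) (by lia))
  have hZ₂ := (van_iff_isZero _ _ _).1 (hP.1.van hZ (i := 2) (by lia))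
  have hY₁ := (van_iff_isZero _ _ _).1 (hP.1.van hY (i := 1) (by lia))
  have hM₁ := (van_iff_isZero _ _ _).1 (hP.1.van_single_neg M (i := -1) (by lia))
  have h₁ : Mono ((homShift (Q.obj P) 1).map g') :=
    ((homFunctor (Q.obj P)).homologySequence_mono_shift_map_mor₂_iff _ hT' 1).2
      (hZ₁.eq_of_src _ _)
  have h₂ : Epi ((homShift (Q.obj P) 1).map g') :=
    ((homFunctor (Q.obj P)).homologySequence_epi_shift_map_mor₂_iff _ hT' 1 2 rfl).2
      (hZ₂.eq_of_tgt _ _)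
  have := isIso_of_mono_of_epi ((homShift (Q.obj P) 1).map g')
  have hN' : HasProjectiveDimensionLT ((homShift (Q.obj P) 1).obj (single.obj N)) 8 :=
    hasProjectiveDimensionLT_eight k hP hR N
  have hY₀ : HasProjectiveDimensionLT ((homShift (Q.obj P) 0).obj Y) 8 :=
    hasProjectiveDimensionLT_of_iso
      ((asIso ((homShift (Q.obj P) 1).map g')).symm ≪≫
        homShiftObjShiftIso (Q.obj P) Y (n := -1) (a := 1) (b := 0) (by lia)) 8
  have hM' : HasProjectiveDimensionLT ((homShift (Q.obj P) 0).obj (single.obj M)) 7 :=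
    hasProjectiveDimensionLT_seven k hP hR M
  have h₃ : Mono ((homShift (Q.obj P) 0).map f) :=
    ((homFunctor (Q.obj P)).homologySequence_mono_shift_map_mor₁_iff _ hT (-1) 0 rfl).2
      (hM₁.eq_of_src _ _)
  have h₄ : Epi ((homShift (Q.obj P) 0).map g) :=
    ((homFunctor (Q.obj P)).homologySequence_epi_shift_map_mor₂_iff _ hT 0 1 rfl).2
      (hY₁.eq_of_tgt _ _)
  have hS : (ShortComplex.mk ((homShift (Q.obj P) 0).map f) ((homShift (Q.obj P) 0).map g)
      ((homFunctor (Q.obj P)).homologySequence_comp _ hT 0)).ShortExact :=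
    { exact := (homFunctor (Q.obj P)).homologySequence_exact₂ _ hT 0
      mono_f := h₃
      epi_g := h₄ }
  exact hS.hasProjectiveDimensionLT_X₂ 8 hY₀ (hasProjectiveDimensionLT_of_ge _ 7 8 (by lia))

omit [IsNoetherianRing R] in
lemma gldLE_end_seven (hP : IsTwoTermSilting R P) (hgld : gldLE.{0, 0} R 2) :
    gldLE.{w, w} (End (Q.obj P))ᵐᵒᵖ 7 := by
  intro V hV
  have : IsNoetherianRing R := IsNoetherianRing.of_finite k R
  refine pdLE_of_hasProjectiveDimensionLT ?_
  obtain ⟨T, hT, h₁, h₂, ⟨e⟩⟩ := exists_triangle_homShift_zero (hP.conn k) V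
  have hLE (K : DerivedCategory (ModuleCat.{0} R)) (hK : K ∈ addOf (Q.obj P)) : K.IsLE 0 := by
    rw [isLE_iff]
    intro i hi
    obtain ⟨n, ⟨r⟩⟩ := exists_retract_of_mem_addOf hK (homologyFunctor (ModuleCat.{0} R) i)
    have := isZero_biproduct
      (fun _ : Fin n => (homologyFunctor (ModuleCat.{0} R) i).obj (Q.obj P))
      (fun _ => isZero_homologyFunctor_of_isLE hP.1.isLE hi)
    rw [IsZero.iff_id_eq_zero, ← r.retract, this.eq_of_tgt r.i 0, zero_comp]
  have hN (K : DerivedCategory (ModuleCat.{0} R)) (hK : K ∈ addOf (Q.obj P)) : NoethHomology K :=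
    fun i => isNoetherian_of_mem_addOf hK (homologyFunctor (ModuleCat.{0} R) i)
      (noethHomology_Q_obj hP.1.2.1 i)
  have := hLE _ h₁
  have := hasProjectiveDimensionLT_eight_of_isLE k hP
    (fun M hM => hasProjectiveDimensionLT_of_pdLE (hgld M hM))
    (isLE_obj₃ hT (n := 0) rfl (hLE _ h₂) (TStructure.t.isLE_of_le _ 0 1 (by lia)))
    (noethHomology_obj₃ hT (hN _ h₁) (hN _ h₂))
  exact hasProjectiveDimensionLT_of_iso e 8

end Main

/-- If `A` is a finite dimensional algebra over a field `k` with
`gl.dim A ≤ 2` and `P` is a 2-term silting complex in `K^b(proj A)`, then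
`B = End_{D^b(A)}(P)` has global dimension at most `7`. -/
theorem gldim_end_le_seven_of_gldim_le_two
    (k A : Type) [Field k] [Ring A] [Algebra k A] [FiniteDimensional k A]
    [HasDerivedCategory.{w} (ModuleCat.{0} Aᵐᵒᵖ)]
    (P : CochainComplex (ModuleCat.{0} Aᵐᵒᵖ) ℤ)
    (hP : IsTwoTermSilting Aᵐᵒᵖ P)
    (hgld : gldLE.{0, 0} Aᵐᵒᵖ 2) :
    gldLE.{w, w} (End (DerivedCategory.Q.obj P))ᵐᵒᵖ 7 := by
  exact gldLE_end_seven k hP hgld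

end

end TwoTermSilting
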